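/- arXiv:math/0404368 — 2 statements merged into one kernel-verified Lean document; each statement's English description precedes it below -/
import Mathlib

section
/- Assume in addition that |det Df(x)| > 1 for every x ∈ K, and let μ_0 be the unique f-invariant Borel probability measure on 𝕋^n absolutely continuous with respect to m. Let (ε_k)_{k≥1} be a sequence of positive real numbers with ε_k → 0; for each k let θ_k be a Borel probability measure on ℝ^n, absolutely continuous with respect to Lebesgue measure, whose support is contained in the closed ball of radius ε_k around the origin and has nonempty interior, and let μ_k be a stationary measure for the random system ((f_v)_v, θ_k). Then μ_k converges to μ_0 in the weak* topology (f is stochastically stable). -/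
open MeasureTheory Set Filter Topology

noncomputable section

/-- The `n`-torus `𝕋ⁿ = ℝⁿ/ℤⁿ`. -/
abbrev Torus (n : ℕ) : Type := Fin n → AddCircle (1 : ℝ)

/-- The canonical projection `ℝⁿ → 𝕋ⁿ`. -/
def tproj (n : ℕ) (x : Fin n → ℝ) : Torus n := fun i => (x i : AddCircle (1 : ℝ))

/-- The set of points of `ℝⁿ` where the inverse of the derivative of the lift `F`
has (operator) norm one. Its projection to the torus is the set `K`. -/
def KsetF (n : ℕ) (F : (Fin n → ℝ) → Fin n → ℝ) : Set (Fin n → ℝ) :=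
  {x | ‖Ring.inverse (fderiv ℝ F x)‖ = 1}

/-- The hypotheses on `f : 𝕋ⁿ → 𝕋ⁿ`: `f` is a `C^{1+α}` local diffeomorphism with
lift `F`, with `‖Df(x)⁻¹‖ ≤ 1` everywhere, and `K = {‖Df(x)⁻¹‖ = 1}` finite. -/
structure TorusHyp (n : ℕ) (α : ℝ) (f : Torus n → Torus n)
    (F : (Fin n → ℝ) → Fin n → ℝ) : Prop where
  hn : 1 ≤ n
  hα0 : 0 < α
  hα1 : α ≤ 1
  hlift : ∀ x, f (tproj n x) = tproj n (F x)
  hdiff : Differentiable ℝ F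
  hHolder : ∃ C : ℝ, ∀ x y, ‖fderiv ℝ F x - fderiv ℝ F y‖ ≤ C * ‖x - y‖ ^ α
  hunit : ∀ x, IsUnit (fderiv ℝ F x)
  hinvnorm : ∀ x, ‖Ring.inverse (fderiv ℝ F x)‖ ≤ 1
  hKfin : (tproj n '' KsetF n F).Finite

/-- The basin of an invariant measure. -/
def basin {n : ℕ} (f : Torus n → Torus n) (μ : Measure (Torus n)) : Set (Torus n) :=
  {x | ∀ φ : C(Torus n, ℝ),
    Tendsto (fun N : ℕ => (N : ℝ)⁻¹ * ∑ j ∈ Finset.range N, φ (f^[j] x)) atTop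
      (𝓝 (∫ y, φ y ∂μ))}

/-- The (closed) support of a measure on a topological space. -/
def mSupport {Y : Type*} [TopologicalSpace Y] [MeasurableSpace Y] (θ : Measure Y) : Set Y :=
  {t | ∀ U ∈ 𝓝 t, θ U ≠ 0}

/-- `μ` is a stationary measure for the random system given by the family `g`
of maps of the torus and the noise distribution `θ`. -/
def IsStationaryT {n : ℕ} (g : (Fin n → ℝ) → Torus n → Torus n)
    (θ : Measure (Fin n → ℝ)) (μ : Measure (Torus n)) : Prop :=
  ∀ φ : C(Torus n, ℝ), ∫ x, ∫ v, φ (g v x) ∂θ ∂μ = ∫ x, φ x ∂μ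

theorem isCoveringMap_of_uniform_balls {E : Type*} [PseudoMetricSpace E] {F : E → E} {r s : ℝ}
    (hs : 0 < s) (hcont : Continuous F) (hopen : IsOpenMap F)
    (hinj : ∀ x, InjOn F (Metric.ball x r))
    (hsurj : ∀ x, Metric.closedBall (F x) s ⊆ F '' Metric.ball x r) : IsCoveringMap F := by
  rw [isCoveringMap_iff_isCoveringMapOn_univ]
  intro y _
  have hex : F ⁻¹' Metric.ball y s ⊆ ⋃ e : F ⁻¹' {y}, Metric.ball (e : E) r := by
    intro z hz
    have hy : y ∈ Metric.closedBall (F z) s := by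
      rw [Metric.mem_closedBall, dist_comm]
      exact (Metric.mem_ball.1 hz).le
    obtain ⟨e, he, hey⟩ := hsurj z hy
    exact mem_iUnion.2 ⟨⟨e, hey⟩, Metric.mem_ball_comm.1 he⟩
  have hdisj : ∀ e e' z : E, F e = F e' → z ∈ Metric.ball e r → z ∈ Metric.ball e' r → e = e' :=
    fun e e' z hee h h' => hinj z (Metric.mem_ball_comm.1 h) (Metric.mem_ball_comm.1 h') hee
  have hdisc : DiscreteTopology (F ⁻¹' {y}) := by
    refine discreteTopology_iff_forall_isOpen.2 fun t => ?_
    refine isOpen_iff_mem_nhds.2 fun e het => ?_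
    have hr : 0 < r := by
      obtain ⟨a, ha, _⟩ := hsurj e (Metric.mem_closedBall_self hs.le)
      exact Metric.pos_of_mem_ball ha
    have : (Subtype.val ⁻¹' Metric.ball (e : E) r : Set (F ⁻¹' {y})) ∈ 𝓝 e :=
      continuous_subtype_val.continuousAt.preimage_mem_nhds (Metric.ball_mem_nhds _ hr)
    refine Filter.mem_of_superset this fun e' he' => ?_
    have : e = e' := Subtype.ext <| hdisj _ _ e' (e.2.trans e'.2.symm) he' (Metric.mem_ball_self hr)
    exact this ▸ het
  rcases isEmpty_or_nonempty (F ⁻¹' {y}) with hemp | hne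
  · refine (IsEvenlyCovered.of_preimage_eq_empty (I := F ⁻¹' {y}) (Metric.ball_mem_nhds y hs) ?_)
    rw [iUnion_of_empty] at hex
    exact subset_empty_iff.1 hex
  have : Nonempty E := ⟨y⟩
  refine .of_trivialization (t := Metric.isOpen_ball.trivializationDiscrete
    (fun e : F ⁻¹' {y} => Metric.ball (e : E) r) (Metric.ball y s) (fun e W hW => ⟨fun h => ?_,
      fun h => ?_⟩) (fun e => hinj e) (fun e => ?_) (fun e e' hee => ?_) hex)
      (Metric.mem_ball_self hs)
  · exact (h.preimage hcont).inter Metric.isOpen_ball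
  · convert hopen _ h using 1
    ext w
    refine ⟨fun hw => ?_, ?_⟩
    · obtain ⟨a, ha, haw⟩ := hsurj e (Metric.ball_subset_closedBall (e.2.symm ▸ hW hw))
      exact ⟨a, ⟨by simpa [haw] using hw, ha⟩, haw⟩
    · rintro ⟨a, ⟨ha, _⟩, rfl⟩
      exact ha
  · intro w hw
    exact hsurj e (Metric.ball_subset_closedBall (e.2.symm ▸ hw))
  · refine disjoint_left.2 fun z hz hz' => hee ?_
    exact Subtype.ext (hdisj _ _ z (e.2.trans e'.2.symm) hz hz')

theorem IsCoveringMap.bijective_of_simplyConnected {E X : Type*} [TopologicalSpace E]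
    [TopologicalSpace X] [SimplyConnectedSpace X] [LocallyPathConnectedSpace X]
    [PreconnectedSpace E] [Nonempty E] {p : E → X} (hp : IsCoveringMap p) :
    Function.Bijective p := by
  obtain ⟨e⟩ := ‹Nonempty E›
  obtain ⟨G, ⟨hG0, hG⟩, -⟩ :=
    hp.existsUnique_continuousMap_lifts (ContinuousMap.id X) (p e) e rfl
  have hl : (G ∘ p : E → E) = id := by
    refine hp.eq_of_comp_eq (G.continuous.comp hp.continuous) continuous_id ?_ e
      (by simpa using hG0)
    rw [← Function.comp_assoc, hG]
    rfl
  exact ⟨Function.LeftInverse.injective (g := G) (congrFun hl),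
    Function.RightInverse.surjective (g := G) (congrFun hG)⟩

/-- A differentiable self-map of a Banach space whose derivative is uniformly continuous and has
inverse of norm at most one is bijective. -/
theorem bijective_of_norm_inverse_fderiv_le {E : Type*} [NormedAddCommGroup E] [NormedSpace ℝ E]
    [CompleteSpace E] {F : E → E} (hF : Differentiable ℝ F)
    (huc : UniformContinuous (fderiv ℝ F)) (hunit : ∀ x, IsUnit (fderiv ℝ F x))
    (hinv : ∀ x, ‖Ring.inverse (fderiv ℝ F x)‖ ≤ 1) : Function.Bijective F := by
  rcases subsingleton_or_nontrivial E with hE | hE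
  · exact ⟨Function.injective_of_subsingleton _, fun y => ⟨y, Subsingleton.elim _ _⟩⟩
  obtain ⟨r, hr, hδ⟩ := Metric.uniformContinuous_iff.1 huc (1 / 2) (by norm_num)
  have happ : ∀ x, ApproximatesLinearOn F (fderiv ℝ F x) (Metric.ball x r) (1 / 2) := by
    intro x a ha b hb
    have := (convex_ball x r).norm_image_sub_le_of_norm_hasFDerivWithin_le' (f := F)
      (f' := fderiv ℝ F) (φ := fderiv ℝ F x) (C := 1 / 2)
      (fun z _ => (hF z).hasFDerivAt.hasFDerivWithinAt)
      (fun z hz => by rw [← dist_eq_norm]; exact (hδ hz).le) hb ha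
    simpa using this
  let e : E → (E ≃L[ℝ] E) := fun x => ContinuousLinearEquiv.ofUnit (hunit x).unit
  have he : ∀ x, ((e x : E ≃L[ℝ] E) : E →L[ℝ] E) = fderiv ℝ F x := fun x => rfl
  have hes : ∀ x, (((e x).symm : E ≃L[ℝ] E) : E →L[ℝ] E) = Ring.inverse (fderiv ℝ F x) := by
    intro x
    conv_rhs => rw [← (hunit x).unit_spec, Ring.inverse_unit]
    rfl
  have hN1 : ∀ x, 1 ≤ ‖(((e x).symm : E ≃L[ℝ] E) : E →L[ℝ] E)‖₊⁻¹ := by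
    intro x
    have : ‖(((e x).symm : E ≃L[ℝ] E) : E →L[ℝ] E)‖₊ ≤ 1 := by
      rw [hes]; exact_mod_cast hinv x
    refine (one_le_inv₀ ?_).2 this
    exact (e x).nnnorm_symm_pos
  have hc : ∀ x, (1 / 2 : NNReal) < ‖(((e x).symm : E ≃L[ℝ] E) : E →L[ℝ] E)‖₊⁻¹ :=
    fun x => lt_of_lt_of_le (by rw [div_lt_one] <;> norm_num) (hN1 x)
  have hinj : ∀ x, InjOn F (Metric.ball x r) := fun x =>
    ((he x).symm ▸ happ x : ApproximatesLinearOn F (e x : E →L[ℝ] E) _ _).injOn (Or.inr (hc x))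
  have hsurj : ∀ x, Metric.closedBall (F x) (r / 4) ⊆ F '' Metric.ball x r := by
    intro x
    have h1 := ((he x).symm ▸ happ x : ApproximatesLinearOn F (e x : E →L[ℝ] E) _ _)
    have h2 := (h1.surjOn_closedBall_of_nonlinearRightInverse (e x).toNonlinearRightInverse
      (ε := r / 2) (b := x) (by positivity)
      (Metric.closedBall_subset_ball (by linarith)))
    have h3 : Metric.closedBall (F x) (r / 4) ⊆ F '' Metric.closedBall x (r / 2) := by
      refine (Metric.closedBall_subset_closedBall ?_).trans h2
      have : (1 : ℝ) ≤ ((e x).toNonlinearRightInverse.nnnorm : ℝ)⁻¹ := by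
        have := hN1 x
        exact_mod_cast this
      push_cast
      nlinarith
    exact h3.trans (image_mono (Metric.closedBall_subset_ball (by linarith)))
  have hopen : IsOpenMap F := by
    refine isOpenMap_iff_nhds_le.2 fun x => ?_
    have h1 := ((he x).symm ▸ happ x : ApproximatesLinearOn F (e x : E →L[ℝ] E) _ _)
    exact (h1.map_nhds_eq (e x).toNonlinearRightInverse (Metric.ball_mem_nhds x hr)
      (Or.inr (hc x))).ge
  exact (isCoveringMap_of_uniform_balls (by positivity) hF.continuous hopen hinj
    hsurj).bijective_of_simplyConnected

/-- The inclusion `ℤⁿ → ℝⁿ`. -/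
def intVec (n : ℕ) : (Fin n → ℤ) →+ (Fin n → ℝ) := (Int.castAddHom ℝ).compLeft (Fin n)

@[simp] theorem intVec_apply {n : ℕ} (l : Fin n → ℤ) (i : Fin n) : intVec n l i = (l i : ℝ) := rfl

theorem intVec_injective (n : ℕ) : Function.Injective (intVec n) := fun a b h => by
  funext i
  exact Int.cast_injective (α := ℝ) (by simpa using congrFun h i)

/-- The half-open unit cube with lower corner `a`. -/
def unitCube {n : ℕ} (a : Fin n → ℝ) : Set (Fin n → ℝ) :=
  Set.univ.pi fun i => Ico (a i) (a i + 1)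

theorem measurableSet_unitCube {n : ℕ} (a : Fin n → ℝ) : MeasurableSet (unitCube a) :=
  MeasurableSet.univ_pi fun _ => measurableSet_Ico

theorem Continuous.integrableOn_unitCube {n : ℕ} {φ : (Fin n → ℝ) → ℝ} (hφ : Continuous φ)
    (a : Fin n → ℝ) : IntegrableOn φ (unitCube a) :=
  (hφ.continuousOn.integrableOn_compact
    (isCompact_univ_pi fun i => isCompact_Icc (a := a i) (b := a i + 1))).mono_set
    (Set.pi_mono fun _ _ => Ico_subset_Icc_self)

theorem existsUnique_add_mem_unitCube {n : ℕ} (a y : Fin n → ℝ) :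
    ∃! l : Fin n → ℤ, y + intVec n l ∈ unitCube a := by
  choose l hl hu using fun i => existsUnique_add_zsmul_mem_Ico (one_pos : (0 : ℝ) < 1) (y i) (a i)
  refine ⟨l, fun i _ => by simpa using hl i, fun l' hl' => ?_⟩
  funext i
  exact hu i (l' i) (by simpa using hl' i (mem_univ i))

theorem setIntegral_eq_of_existsUnique {n : ℕ} {A : (Fin n → ℤ) →+ (Fin n → ℤ)}
    {s t : Set (Fin n → ℝ)} (hs : MeasurableSet s) (ht : MeasurableSet t)
    (hs' : ∀ y, ∃! l, y + intVec n (A l) ∈ s) (ht' : ∀ y, ∃! l, y + intVec n (A l) ∈ t)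
    {Φ : (Fin n → ℝ) → ℝ} (hΦ : ∀ y l, Φ (y + intVec n (A l)) = Φ y) :
    ∫ y in s, Φ y = ∫ y in t, Φ y := by
  let Γ : AddSubgroup (Fin n → ℝ) := ((intVec n).comp A).range
  have hcount : Countable Γ := (Set.countable_range ((intVec n).comp A)).to_subtype
  have key : ∀ u : Set (Fin n → ℝ), MeasurableSet u → (∀ y, ∃! l, y + intVec n (A l) ∈ u) →
      IsAddFundamentalDomain Γ u volume := by
    intro u hu hu'
    refine IsAddFundamentalDomain.mk' hu.nullMeasurableSet fun y => ?_
    obtain ⟨l, hl, hl'⟩ := hu' y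
    refine ⟨⟨intVec n (A l), l, rfl⟩, ?_, ?_⟩
    · change intVec n (A l) + y ∈ u
      rwa [add_comm]
    · rintro ⟨_, l', rfl⟩ h
      have : l' = l := hl' l' (by
        change intVec n (A l') + y ∈ u at h
        rwa [add_comm] at h)
      subst this
      rfl
  refine (key s hs hs').setIntegral_eq (key t ht ht') ?_
  rintro ⟨_, l, rfl⟩ y
  change Φ (intVec n (A l) + y) = Φ y
  rw [add_comm, hΦ]

/-- A bijective lift `F` of a torus endomorphism, with inverse `G`, action `A` on the lattice `ℤⁿ`
and a set `R` of representatives of `ℤⁿ / A ℤⁿ`; `w` is the inverse Jacobian seen from the image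
point. -/
structure BranchSystem {n : ℕ} (F G : (Fin n → ℝ) → Fin n → ℝ) (w : (Fin n → ℝ) → ℝ)
    (A : (Fin n → ℤ) →+ (Fin n → ℤ)) (R : Finset (Fin n → ℤ)) : Prop where
  F_G : ∀ y, F (G y) = y
  G_F : ∀ x, G (F x) = x
  F_add : ∀ x l, F (x + intVec n l) = F x + intVec n (A l)
  existsUnique_rep : ∀ k, ∃! l, k + A l ∈ R
  differentiable_F : Differentiable ℝ F
  w_mul_det : ∀ x, w (F x) * |(fderiv ℝ F x).det| = 1
  w_add : ∀ y l, w (y + intVec n (A l)) = w y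
  continuous_w : Continuous w
  w_pos : ∀ y, 0 < w y
  norm_G_sub_le : ∀ y y', ‖G y - G y'‖ ≤ ‖y - y'‖

/-- The transfer operator of `x ↦ F x + v`. -/
def transfer {n : ℕ} (G : (Fin n → ℝ) → Fin n → ℝ) (w : (Fin n → ℝ) → ℝ)
    (R : Finset (Fin n → ℤ)) (v : Fin n → ℝ) (φ : (Fin n → ℝ) → ℝ) (y : Fin n → ℝ) : ℝ :=
  ∑ k ∈ R, w (y - v + intVec n k) * φ (G (y - v + intVec n k))

/-- Invariance under integer translations. -/
def LatticePeriodic {n : ℕ} (φ : (Fin n → ℝ) → ℝ) : Prop :=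
  ∀ x l, φ (x + intVec n l) = φ x

namespace BranchSystem

variable {n : ℕ} {F G : (Fin n → ℝ) → Fin n → ℝ} {w : (Fin n → ℝ) → ℝ}
    {A : (Fin n → ℤ) →+ (Fin n → ℤ)} {R : Finset (Fin n → ℤ)}

theorem G_add (h : BranchSystem F G w A R) (y : Fin n → ℝ) (l : Fin n → ℤ) :
    G (y + intVec n (A l)) = G y + intVec n l := by
  conv_lhs => rw [← h.F_G y]
  rw [← h.F_add, h.G_F]

theorem continuous_G (h : BranchSystem F G w A R) : Continuous G := by
  have : LipschitzWith 1 G := LipschitzWith.of_dist_le_mul fun x y => by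
    simpa [dist_eq_norm] using h.norm_G_sub_le x y
  exact this.continuous

theorem continuous_transfer (h : BranchSystem F G w A R) (v : Fin n → ℝ) {φ : (Fin n → ℝ) → ℝ}
    (hφ : Continuous φ) : Continuous (transfer G w R v φ) := by
  have := h.continuous_G
  have := h.continuous_w
  unfold transfer
  fun_prop

theorem sum_translate (h : BranchSystem F G w A R) {Φ : (Fin n → ℝ) → ℝ}
    (hΦ : ∀ y l, Φ (y + intVec n (A l)) = Φ y) (y : Fin n → ℝ) (l : Fin n → ℤ) :
    ∑ k ∈ R, Φ (y + intVec n l + intVec n k) = ∑ k ∈ R, Φ (y + intVec n k) := by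
  choose r hr hru using h.existsUnique_rep
  have key : ∀ k k' m : Fin n → ℤ, k ∈ R → k' ∈ R → k' = k + A m → k' = k := by
    intro k k' m hk hk' e
    have h0 : (0 : Fin n → ℤ) = r k := hru k 0 (by simpa using hk)
    have h1 : m = r k := hru k m (by simpa [← e] using hk')
    rw [e, h1, ← h0, map_zero, add_zero]
  refine Finset.sum_bij' (fun k _ => k + l + A (r (k + l))) (fun k _ => k - l + A (r (k - l)))
    (fun k _ => hr _) (fun k _ => hr _) (fun k hk => ?_) (fun k hk => ?_) (fun k hk => ?_)
  · refine key k _ (r (k + l) + r (k + l + A (r (k + l)) - l)) hk (hr _) ?_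
    rw [map_add]; abel
  · refine key k _ (r (k - l) + r (k - l + A (r (k - l)) + l)) hk (hr _) ?_
    rw [map_add]; abel
  · rw [map_add, ← add_assoc, hΦ, map_add]
    congr 1; abel

theorem latticePeriodic_transfer (h : BranchSystem F G w A R) (v : Fin n → ℝ)
    {φ : (Fin n → ℝ) → ℝ} (hφ : LatticePeriodic φ) : LatticePeriodic (transfer G w R v φ) := by
  intro y l
  have := h.sum_translate (Φ := fun z => w z * φ (G z))
    (fun z m => by simp only [h.w_add, h.G_add, hφ _ m]) (y - v) l
  simpa only [transfer, add_sub_right_comm] using this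

/-- Duality between composition with `x ↦ F x + v` and the transfer operator. -/
theorem setIntegral_comp_mul (h : BranchSystem F G w A R) (v : Fin n → ℝ)
    {φ ψ : (Fin n → ℝ) → ℝ} (hφc : Continuous φ) (hψc : Continuous ψ)
    (hφ : LatticePeriodic φ) (hψ : LatticePeriodic ψ) :
    ∫ x in unitCube 0, ψ (F x + v) * φ x = ∫ y in unitCube 0, ψ y * transfer G w R v φ y := by
  set Φ : (Fin n → ℝ) → ℝ := fun y => ψ y * (w (y - v) * φ (G (y - v))) with hΦ
  have hGc := h.continuous_G
  have hwc := h.continuous_w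
  have hΦc : Continuous Φ := by fun_prop
  have hΦA : ∀ y l, Φ (y + intVec n (A l)) = Φ y := by
    intro y l
    simp only [hΦ, add_sub_right_comm, h.w_add, h.G_add, hφ _ _, hψ _ _]
  have hinj : InjOn (fun x => F x + v) (unitCube 0) := by
    intro x _ y _ hxy
    rw [← h.G_F x, ← h.G_F y, add_right_cancel hxy]
  have hder : ∀ x, HasFDerivAt (fun x => F x + v) (fderiv ℝ F x) x := fun x =>
    (h.differentiable_F x).hasFDerivAt.add_const v
  have h1 : ∫ x in unitCube 0, ψ (F x + v) * φ x
      = ∫ y in (fun x => F x + v) '' unitCube 0, Φ y := by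
    rw [integral_image_eq_integral_abs_det_fderiv_smul volume (measurableSet_unitCube 0)
      (fun x _ => (hder x).hasFDerivWithinAt) hinj]
    refine integral_congr_ae (Eventually.of_forall fun x => ?_)
    have := h.w_mul_det x
    simp only [hΦ, add_sub_cancel_right, h.G_F, smul_eq_mul]
    linear_combination (-(ψ (F x + v) * φ x)) * this
  let S : (Fin n → ℤ) → Set (Fin n → ℝ) := fun k => unitCube (intVec n k)
  have hSmem : ∀ y k, y ∈ S k ↔ (fun i => ⌊y i⌋) = k := by
    intro y k
    simp only [S, unitCube, Set.mem_univ_pi, mem_Ico, funext_iff, Int.floor_eq_iff, intVec_apply]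
  have h2 : ∫ y in (fun x => F x + v) '' unitCube 0, Φ y = ∫ y in ⋃ k ∈ R, S k, Φ y := by
    refine setIntegral_eq_of_existsUnique ?_ ?_ (A := A) ?_ ?_ hΦA
    · exact measurable_image_of_fderivWithin (measurableSet_unitCube 0)
        (fun x _ => (hder x).hasFDerivWithinAt) hinj
    · exact R.measurableSet_biUnion fun k _ => measurableSet_unitCube _
    · intro y
      have hiff : ∀ l, y + intVec n (A l) ∈ (fun x => F x + v) '' unitCube 0 ↔
          G (y - v) + intVec n l ∈ unitCube 0 := by
        intro l
        rw [← h.G_add]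
        refine ⟨?_, fun hx => ⟨_, hx, ?_⟩⟩
        · rintro ⟨x, hx, hxy⟩
          have : y - v + intVec n (A l) = F x := by
            rw [sub_add_eq_add_sub, ← hxy]; simp
          rwa [this, h.G_F]
        · simp only [h.F_G]; abel
      simpa only [hiff] using existsUnique_add_mem_unitCube 0 (G (y - v))
    · intro y
      have hiff : ∀ l, y + intVec n (A l) ∈ ⋃ k ∈ R, S k ↔ (fun i => ⌊y i⌋) + A l ∈ R := by
        intro l
        simp only [mem_iUnion₂, hSmem]
        have : (fun i => ⌊(y + intVec n (A l)) i⌋) = (fun i => ⌊y i⌋) + A l := by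
          funext i; simp
        rw [this]
        simp
      simpa only [hiff] using h.existsUnique_rep fun i => ⌊y i⌋
  have h3 : ∫ y in ⋃ k ∈ R, S k, Φ y = ∑ k ∈ R, ∫ y in S k, Φ y := by
    refine integral_biUnion_finset R (fun k _ => measurableSet_unitCube _) ?_
      fun k _ => hΦc.integrableOn_unitCube _
    intro k _ k' _ hkk
    refine disjoint_left.2 fun y hy hy' => hkk ?_
    rw [← (hSmem y k).1 hy, ← (hSmem y k').1 hy']
  have h4 : ∀ k, ∫ y in S k, Φ y = ∫ y in unitCube 0, Φ (y + intVec n k) := by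
    intro k
    have hpre : (fun y => y + intVec n k) ⁻¹' S k = unitCube 0 := by
      ext y
      simp only [S, unitCube, Set.mem_preimage, Set.mem_univ_pi, mem_Ico, Pi.add_apply,
        intVec_apply, Pi.zero_apply]
      refine forall_congr' fun i => ⟨fun hi => ?_, fun hi => ?_⟩ <;> constructor <;>
        linarith [hi.1, hi.2]
    rw [← hpre]
    exact ((measurePreserving_add_right volume (intVec n k)).setIntegral_preimage_emb
      (measurableEmbedding_addRight _) Φ (S k)).symm
  rw [h1, h2, h3, Finset.sum_congr rfl fun k _ => h4 k, ← integral_finsetSum]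
  · refine integral_congr_ae (Eventually.of_forall fun y => ?_)
    simp only [hΦ, transfer, Finset.mul_sum, hψ y, add_sub_right_comm]
  · exact fun k _ => Continuous.integrableOn_unitCube (by fun_prop) _

end BranchSystem

/-- The iterates of the weighted transfer operators `φ ↦ L_{v i} (c φ)`. -/
def transferIterate {n : ℕ} (G : (Fin n → ℝ) → Fin n → ℝ) (w : (Fin n → ℝ) → ℝ)
    (R : Finset (Fin n → ℤ)) (v : ℕ → Fin n → ℝ) (c φ : (Fin n → ℝ) → ℝ) :
    ℕ → (Fin n → ℝ) → ℝ
  | 0 => φ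
  | N + 1 => transfer G w R (v N) fun x => c x * transferIterate G w R v c φ N x

theorem setIntegral_unitCube_eq {n : ℕ} {φ : (Fin n → ℝ) → ℝ} (hφ : LatticePeriodic φ)
    (a b : Fin n → ℝ) : ∫ y in unitCube a, φ y = ∫ y in unitCube b, φ y :=
  setIntegral_eq_of_existsUnique (A := AddMonoidHom.id _) (measurableSet_unitCube a)
    (measurableSet_unitCube b) (existsUnique_add_mem_unitCube a) (existsUnique_add_mem_unitCube b)
    hφ

theorem setIntegral_unitCube_const {n : ℕ} (a : Fin n → ℝ) (m : ℝ) :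
    ∫ _ in unitCube a, m = m := by
  have : volume (unitCube a) = 1 := by
    simp [unitCube, volume_pi, Measure.pi_pi]
  simp [this, Measure.real]

theorem mul_pow_le_setIntegral_unitCube {n : ℕ} {φ : (Fin n → ℝ) → ℝ} (hφc : Continuous φ)
    (hφ : LatticePeriodic φ) (hφ0 : ∀ x, 0 ≤ φ x) {δ m : ℝ} (hδ0 : 0 < δ) (hδ : δ ≤ 1 / 2)
    (y : Fin n → ℝ) (hm : ∀ z, ‖z - y‖ < δ → m ≤ φ z) :
    m * (2 * δ) ^ n ≤ ∫ x in unitCube 0, φ x := by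
  have hsub : Metric.ball y δ ⊆ unitCube fun i => y i - 1 / 2 := by
    intro z hz i _
    have h1 : |z i - y i| < δ := by
      have := norm_le_pi_norm (z - y) i
      rw [mem_ball_iff_norm] at hz
      exact lt_of_le_of_lt this hz
    rw [abs_lt] at h1
    constructor <;> linarith
  have hvol : volume.real (Metric.ball y δ) = (2 * δ) ^ n := by
    rw [Measure.real, Real.volume_pi_ball _ hδ0, ENNReal.toReal_ofReal (by positivity),
      Fintype.card_fin]
  have hint := hφc.integrableOn_unitCube fun i => y i - 1 / 2
  rw [setIntegral_unitCube_eq hφ 0 fun i => y i - 1 / 2]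
  calc m * (2 * δ) ^ n = ∫ _ in Metric.ball y δ, m := by simp [hvol, mul_comm]
    _ ≤ ∫ x in Metric.ball y δ, φ x := by
      refine setIntegral_mono_on (integrableOn_const measure_ball_lt_top.ne) (hint.mono_set hsub)
        measurableSet_ball fun z hz => hm z ?_
      rwa [mem_ball_iff_norm] at hz
    _ ≤ _ := setIntegral_mono_set hint (Eventually.of_forall hφ0) hsub.eventuallyLE

namespace BranchSystem

variable {n : ℕ} {F G : (Fin n → ℝ) → Fin n → ℝ} {w : (Fin n → ℝ) → ℝ}
    {A : (Fin n → ℤ) →+ (Fin n → ℤ)} {R : Finset (Fin n → ℤ)}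

theorem transfer_nonneg (h : BranchSystem F G w A R) (v : Fin n → ℝ) {φ : (Fin n → ℝ) → ℝ}
    (hφ : ∀ x, 0 ≤ φ x) (y : Fin n → ℝ) : 0 ≤ transfer G w R v φ y :=
  Finset.sum_nonneg fun _ _ => mul_nonneg (h.w_pos _).le (hφ _)

theorem transferIterate_nonneg (h : BranchSystem F G w A R) (v : ℕ → Fin n → ℝ)
    {c φ : (Fin n → ℝ) → ℝ} (hc : ∀ x, 0 ≤ c x) (hφ : ∀ x, 0 ≤ φ x) (N : ℕ) (y : Fin n → ℝ) :
    0 ≤ transferIterate G w R v c φ N y := by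
  induction N generalizing y with
  | zero => exact hφ y
  | succ N ih => exact h.transfer_nonneg _ (fun x => mul_nonneg (hc x) (ih x)) y

theorem transferIterate_congr {v v' : ℕ → Fin n → ℝ} {c φ : (Fin n → ℝ) → ℝ} {N : ℕ}
    (hv : ∀ i < N, v i = v' i) :
    transferIterate G w R v c φ N = transferIterate G w R v' c φ N := by
  induction N with
  | zero => rfl
  | succ N ih =>
    simp only [transferIterate, ih fun i hi => hv i (by omega), hv N (by omega)]

theorem transferIterate_add (v : ℕ → Fin n → ℝ) (c φ : (Fin n → ℝ) → ℝ) (M N : ℕ) :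
    transferIterate G w R v c φ (M + N) =
      transferIterate G w R (fun i => v (M + i)) c (transferIterate G w R v c φ M) N := by
  induction N with
  | zero => rfl
  | succ N ih => rw [← add_assoc]; simp only [transferIterate, ih]

theorem continuous_transferIterate (h : BranchSystem F G w A R) (v : ℕ → Fin n → ℝ)
    {φ : (Fin n → ℝ) → ℝ} (hφ : Continuous φ) (N : ℕ) :
    Continuous (transferIterate G w R v (fun _ => 1) φ N) := by
  induction N with
  | zero => exact hφ
  | succ N ih => exact h.continuous_transfer _ (by fun_prop)

theorem latticePeriodic_transferIterate (h : BranchSystem F G w A R) (v : ℕ → Fin n → ℝ)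
    {φ : (Fin n → ℝ) → ℝ} (hφ : LatticePeriodic φ) (N : ℕ) :
    LatticePeriodic (transferIterate G w R v (fun _ => 1) φ N) := by
  induction N with
  | zero => exact hφ
  | succ N ih => exact h.latticePeriodic_transfer _ fun x l => by simp only [ih x l]

theorem setIntegral_transferIterate (h : BranchSystem F G w A R) (v : ℕ → Fin n → ℝ)
    {φ : (Fin n → ℝ) → ℝ} (hφc : Continuous φ) (hφ : LatticePeriodic φ) (N : ℕ) :
    ∫ y in unitCube 0, transferIterate G w R v (fun _ => 1) φ N y = ∫ y in unitCube 0, φ y := by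
  induction N with
  | zero => rfl
  | succ N ih =>
    rw [← ih]
    have := h.setIntegral_comp_mul (v N) (ψ := fun _ => 1)
      (h.continuous_transferIterate v hφc N) continuous_const
      (h.latticePeriodic_transferIterate v hφ N) fun _ _ => rfl
    simpa [transferIterate] using this.symm

/-- Bounded distortion up to a subexponential error. -/
theorem exists_transferIterate_one_le (h : BranchSystem F G w A R) (hw : UniformContinuous w)
    {w₀ : ℝ} (hw₀ : 0 < w₀) (hw₀w : ∀ y, w₀ ≤ w y) {ω : ℝ} (hω : 0 < ω) :
    ∃ C > 0, ∀ (v : ℕ → Fin n → ℝ) N y,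
      transferIterate G w R v (fun _ => 1) (fun _ => 1) N y ≤ C * (1 + ω) ^ N := by
  obtain ⟨δ₁, hδ₁, hδw⟩ := Metric.uniformContinuous_iff.1 hw (ω * w₀) (by positivity)
  set δ := min δ₁ (1 / 2)
  have hδ : 0 < δ := by positivity
  have hwle : ∀ y y', ‖y - y'‖ < δ → w y ≤ (1 + ω) * w y' := by
    intro y y' hy
    have h1 := hδw (a := y) (b := y') (by
      rw [dist_eq_norm]; exact hy.trans_le (min_le_left _ _))
    rw [Real.dist_eq, abs_lt] at h1
    nlinarith [hw₀w y']
  have key : ∀ (v : ℕ → Fin n → ℝ) N y y', ‖y - y'‖ < δ →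
      transferIterate G w R v (fun _ => 1) (fun _ => 1) N y ≤
        (1 + ω) ^ N * transferIterate G w R v (fun _ => 1) (fun _ => 1) N y' := by
    intro v N
    induction N with
    | zero => intro y y' _; simp [transferIterate]
    | succ N ih =>
      intro y y' hy
      simp only [transferIterate, transfer, one_mul, Finset.mul_sum]
      refine Finset.sum_le_sum fun k _ => ?_
      have hz : ‖(y - v N + intVec n k) - (y' - v N + intVec n k)‖ < δ := by
        simpa using hy
      have h1 := hwle _ _ hz
      have h2 := ih _ _ ((h.norm_G_sub_le _ _).trans_lt hz)
      calc _ ≤ ((1 + ω) * w (y' - v N + intVec n k)) * _ :=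
            mul_le_mul h1 h2 (h.transferIterate_nonneg v (fun _ => zero_le_one)
              (fun _ => zero_le_one) _ _) (mul_nonneg (by positivity) (h.w_pos _).le)
        _ = _ := by ring
  refine ⟨((2 * δ) ^ n)⁻¹, by positivity, fun v N y => ?_⟩
  have hper : LatticePeriodic (fun _ : Fin n → ℝ => (1 : ℝ)) := fun _ _ => rfl
  have h1 := mul_pow_le_setIntegral_unitCube (h.continuous_transferIterate v continuous_const N)
    (h.latticePeriodic_transferIterate v hper N) (h.transferIterate_nonneg v
      (fun _ => zero_le_one) (fun _ => zero_le_one) N) hδ (min_le_right _ _) y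
    (m := ((1 + ω) ^ N)⁻¹ * transferIterate G w R v (fun _ => 1) (fun _ => 1) N y) (fun z hz => by
      rw [inv_mul_le_iff₀ (by positivity)]
      exact key v N y z (by rwa [norm_sub_rev]))
  rw [h.setIntegral_transferIterate v continuous_const hper, setIntegral_unitCube_const] at h1
  rw [mul_assoc, inv_mul_le_iff₀ (by positivity), mul_one] at h1
  rw [inv_mul_eq_div, le_div_iff₀ (by positivity)]
  exact h1

theorem transferIterate_sq_le (h : BranchSystem F G w A R) (v : ℕ → Fin n → ℝ)
    (c : (Fin n → ℝ) → ℝ) (N : ℕ) (y : Fin n → ℝ) :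
    transferIterate G w R v c (fun _ => 1) N y ^ 2 ≤
      transferIterate G w R v (fun x => c x ^ 2) (fun _ => 1) N y *
        transferIterate G w R v (fun _ => 1) (fun _ => 1) N y := by
  induction N generalizing y with
  | zero => simp [transferIterate]
  | succ N ih =>
    simp only [transferIterate, transfer]
    refine Finset.sum_sq_le_sum_mul_sum_of_sq_le_mul R (fun k _ => ?_) (fun k _ => ?_)
      fun k _ => ?_
    · exact mul_nonneg (h.w_pos _).le (mul_nonneg (sq_nonneg _) (h.transferIterate_nonneg v
        (fun _ => sq_nonneg _) (fun _ => zero_le_one) _ _))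
    · exact mul_nonneg (h.w_pos _).le (mul_nonneg zero_le_one (h.transferIterate_nonneg v
        (fun _ => zero_le_one) (fun _ => zero_le_one) _ _))
    · have h1 := ih (G (y - v N + intVec n k))
      have h2 : 0 ≤ (w (y - v N + intVec n k) * c (G (y - v N + intVec n k))) ^ 2 := sq_nonneg _
      nlinarith [mul_le_mul_of_nonneg_left h1 h2]

end BranchSystem

/-- Uniform exponential decay of the weighted transfer operators with noise of size `ε`. -/
def TransferDecay {n : ℕ} (G : (Fin n → ℝ) → Fin n → ℝ) (w : (Fin n → ℝ) → ℝ)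
    (R : Finset (Fin n → ℤ)) (ε : ℝ) (c : (Fin n → ℝ) → ℝ) : Prop :=
  ∃ C > 0, ∃ r, 0 < r ∧ r < 1 ∧ ∀ v : ℕ → Fin n → ℝ, (∀ i, ‖v i‖ ≤ ε) → ∀ N y,
    transferIterate G w R v c (fun _ => 1) N y ≤ C * r ^ N

theorem TransferDecay.of_sq {n : ℕ} {F G : (Fin n → ℝ) → Fin n → ℝ} {w : (Fin n → ℝ) → ℝ}
    {A : (Fin n → ℤ) →+ (Fin n → ℤ)} {R : Finset (Fin n → ℤ)} (h : BranchSystem F G w A R)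
    (hw : UniformContinuous w) {w₀ : ℝ} (hw₀ : 0 < w₀) (hw₀w : ∀ y, w₀ ≤ w y) {ε : ℝ}
    {c : (Fin n → ℝ) → ℝ} (hdec : TransferDecay G w R ε fun x => c x ^ 2) :
    TransferDecay G w R ε c := by
  obtain ⟨C, hC, r, hr0, hr1, hdec⟩ := hdec
  have hω : 0 < (1 - r) / (2 * r) := div_pos (by linarith) (by linarith)
  obtain ⟨D, hD, hdist⟩ := h.exists_transferIterate_one_le hw hw₀ hw₀w hω
  have hq : r * (1 + (1 - r) / (2 * r)) = (1 + r) / 2 := by field_simp; ring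
  refine ⟨√(C * D), by positivity, √((1 + r) / 2), by positivity, ?_, fun v hv N y => ?_⟩
  · rw [Real.sqrt_lt' one_pos]; linarith
  · refine le_trans (Real.le_sqrt_of_sq_le ?_) (le_of_eq ?_) (b := √(C * D * ((1 + r) / 2) ^ N))
    · refine (h.transferIterate_sq_le v c N y).trans ?_
      calc _ ≤ (C * r ^ N) * (D * (1 + (1 - r) / (2 * r)) ^ N) :=
            mul_le_mul (hdec v hv N y) (hdist v N y) (h.transferIterate_nonneg v
              (fun _ => zero_le_one) (fun _ => zero_le_one) _ _) (by positivity)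
        _ = _ := by rw [← hq, mul_pow]; ring
    · rw [Real.sqrt_mul (by positivity)]
      congr 1
      rw [Real.sqrt_eq_iff_eq_sq (by positivity) (by positivity), ← pow_mul, mul_comm N, pow_mul,
        Real.sq_sqrt (by positivity)]

namespace BranchSystem

variable {n : ℕ} {F G : (Fin n → ℝ) → Fin n → ℝ} {w : (Fin n → ℝ) → ℝ}
    {A : (Fin n → ℤ) →+ (Fin n → ℤ)} {R : Finset (Fin n → ℤ)}

theorem abs_transferIterate_le (h : BranchSystem F G w A R) (hw1 : ∀ y, w y ≤ 1)
    (v : ℕ → Fin n → ℝ) {φ : (Fin n → ℝ) → ℝ} {S : ℝ} (hS : ∀ x, |φ x| ≤ S) (N : ℕ)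
    (y : Fin n → ℝ) : |transferIterate G w R v (fun _ => 1) φ N y| ≤ (R.card : ℝ) ^ N * S := by
  induction N generalizing y with
  | zero => simpa [transferIterate] using hS y
  | succ N ih =>
    calc _ ≤ ∑ k ∈ R, (R.card : ℝ) ^ N * S := by
          refine (Finset.abs_sum_le_sum_abs _ _).trans (Finset.sum_le_sum fun k _ => ?_)
          simp only [one_mul, abs_mul, abs_of_pos (h.w_pos _)]
          exact (mul_le_of_le_one_left (abs_nonneg _) (hw1 _)).trans (ih _)
      _ = _ := by rw [Finset.sum_const, nsmul_eq_mul]; ring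

/-- The iterated Lasota–Yorke inequality. -/
theorem exists_gauge_transferIterate (h : BranchSystem F G w A R) {α δ₀ Cw : ℝ}
    (hCw : 0 ≤ Cw) (hw1 : ∀ y, w y ≤ 1)
    (hwH : ∀ y y', |w y - w y'| ≤ Cw * ‖y - y'‖ ^ α) {c : (Fin n → ℝ) → ℝ}
    (hc0 : ∀ x, 0 ≤ c x) (hc1 : ∀ x, c x ≤ 1)
    (hG : ∀ y y', ‖y - y'‖ ≤ δ₀ → ‖G y - G y'‖ ^ α ≤ c (G y) * ‖y - y'‖ ^ α) (N : ℕ) :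
    ∃ D ≥ 0, ∀ (v : ℕ → Fin n → ℝ) (φ : (Fin n → ℝ) → ℝ) (H S : ℝ), 0 ≤ H →
      (∀ x, |φ x| ≤ S) → (∀ x x', ‖x - x'‖ ≤ δ₀ → |φ x - φ x'| ≤ H * ‖x - x'‖ ^ α) →
      ∀ y y', ‖y - y'‖ ≤ δ₀ →
        |transferIterate G w R v (fun _ => 1) φ N y - transferIterate G w R v (fun _ => 1) φ N y'|
          ≤ (H * transferIterate G w R v c (fun _ => 1) N y + D * S) * ‖y - y'‖ ^ α := by
  induction N with
  | zero =>
    refine ⟨0, le_rfl, fun v φ H S _ _ hφ y y' hy => ?_⟩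
    simpa [transferIterate] using hφ y y' hy
  | succ N ih =>
    obtain ⟨D, hD, ih⟩ := ih
    refine ⟨R.card * (D + Cw * R.card ^ N), by positivity, fun v φ H S hH hS hφ y y' hy => ?_⟩
    have hS0 : 0 ≤ S := (abs_nonneg _).trans (hS 0)
    simp only [transferIterate, transfer, one_mul, ← Finset.sum_sub_distrib, Finset.mul_sum]
    have hcard : (R.card : ℝ) * (D + Cw * R.card ^ N) * S =
        ∑ _k ∈ R, (D + Cw * R.card ^ N) * S := by
      rw [Finset.sum_const, nsmul_eq_mul]; ring
    rw [hcard, ← Finset.sum_add_distrib, Finset.sum_mul]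
    refine (Finset.abs_sum_le_sum_abs _ _).trans (Finset.sum_le_sum fun k _ => ?_)
    set z := y - v N + intVec n k
    set z' := y' - v N + intVec n k
    set Φ := transferIterate G w R v (fun _ => 1) φ N
    set T := transferIterate G w R v c (fun _ => 1) N
    have hz : ‖z - z'‖ = ‖y - y'‖ := by simp [z, z']
    have hp : 0 ≤ ‖y - y'‖ ^ α := Real.rpow_nonneg (norm_nonneg _) _
    have h1 := ih v φ H S hH hS hφ (G z) (G z') ((h.norm_G_sub_le _ _).trans (hz ▸ hy))
    have h2 : ‖G z - G z'‖ ^ α ≤ c (G z) * ‖y - y'‖ ^ α := hz ▸ hG z z' (hz ▸ hy)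
    have h3 : |w z - w z'| ≤ Cw * ‖y - y'‖ ^ α := hz ▸ hwH z z'
    have h4 : |Φ (G z')| ≤ R.card ^ N * S := h.abs_transferIterate_le hw1 v hS N _
    have hT : 0 ≤ T (G z) := h.transferIterate_nonneg v hc0 (fun _ => zero_le_one) N _
    calc |w z * Φ (G z) - w z' * Φ (G z')|
        = |w z * (Φ (G z) - Φ (G z')) + (w z - w z') * Φ (G z')| := by congr 1; ring
      _ ≤ w z * |Φ (G z) - Φ (G z')| + |w z - w z'| * |Φ (G z')| := by
        refine (abs_add_le _ _).trans_eq ?_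
        rw [abs_mul, abs_mul, abs_of_pos (h.w_pos _)]
      _ ≤ w z * ((H * T (G z) + D * S) * (c (G z) * ‖y - y'‖ ^ α)) +
          Cw * ‖y - y'‖ ^ α * (R.card ^ N * S) := by
        refine add_le_add (mul_le_mul_of_nonneg_left (h1.trans ?_) (h.w_pos _).le)
          (mul_le_mul h3 h4 (abs_nonneg _) (by positivity))
        exact mul_le_mul_of_nonneg_left h2 (by positivity)
      _ = (H * (w z * (c (G z) * T (G z))) + w z * c (G z) * (D * S) +
          Cw * R.card ^ N * S) * ‖y - y'‖ ^ α := by ring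
      _ ≤ _ := by
        refine mul_le_mul_of_nonneg_right ?_ hp
        have : w z * c (G z) * (D * S) ≤ 1 * (D * S) :=
          mul_le_mul_of_nonneg_right (mul_le_one₀ (hw1 _) (hc0 _) (hc1 _)) (by positivity)
        linarith

/-- Eventual domination of the iterates of a Hölder function by its mean. -/
theorem exists_transferIterate_le (h : BranchSystem F G w A R) {α δ₀ Cw ε : ℝ} (hα : 0 < α)
    (hδ₀ : 0 < δ₀) (hCw : 0 ≤ Cw) (hw1 : ∀ y, w y ≤ 1)
    (hwH : ∀ y y', |w y - w y'| ≤ Cw * ‖y - y'‖ ^ α) {c : (Fin n → ℝ) → ℝ}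
    (hc0 : ∀ x, 0 ≤ c x) (hc1 : ∀ x, c x ≤ 1)
    (hG : ∀ y y', ‖y - y'‖ ≤ δ₀ → ‖G y - G y'‖ ^ α ≤ c (G y) * ‖y - y'‖ ^ α)
    (hdec : TransferDecay G w R ε c) :
    ∃ C > 0, ∃ N₀ : ℕ, ∀ (φ : (Fin n → ℝ) → ℝ) (H : ℝ), Continuous φ → LatticePeriodic φ →
      (∀ x, 0 ≤ φ x) → 0 ≤ H → (∀ x x', |φ x - φ x'| ≤ H * ‖x - x'‖ ^ α) →
      ∀ v : ℕ → Fin n → ℝ, (∀ i, ‖v i‖ ≤ ε) → ∀ (j : ℕ) y,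
        transferIterate G w R v (fun _ => 1) φ (j * N₀) y ≤
          C * (∫ x in unitCube 0, φ x) + H / 2 ^ j := by
  obtain ⟨C, hC, r, hr0, hr1, hdec⟩ := hdec
  obtain ⟨N₀, hN₀⟩ := exists_pow_lt_of_lt_one (show 0 < 1 / (4 * C) by positivity) hr1
  have hN₀' : C * r ^ N₀ ≤ 1 / 4 := by
    calc C * r ^ N₀ ≤ C * (1 / (4 * C)) := by gcongr
      _ = 1 / 4 := by field_simp
  obtain ⟨D, hD, hLY⟩ := h.exists_gauge_transferIterate hCw hw1 hwH hc0 hc1 hG N₀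
  obtain ⟨δ, hδ, hδδ, hδ2, hδα⟩ : ∃ δ > 0, δ ≤ δ₀ ∧ δ ≤ 1 / 2 ∧ D * δ ^ α ≤ 1 / 4 := by
    have hlim : Tendsto (fun δ : ℝ => D * δ ^ α) (𝓝 0) (𝓝 (D * 0 ^ α)) :=
      ((Real.continuousAt_rpow_const 0 α (Or.inr hα.le)).tendsto).const_mul D
    rw [Real.zero_rpow hα.ne', mul_zero] at hlim
    have h1 : ∀ᶠ δ in 𝓝[>] (0 : ℝ), D * δ ^ α < 1 / 4 :=
      nhdsWithin_le_nhds (hlim.eventually_lt_const (by norm_num))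
    have h2 : ∀ᶠ δ in 𝓝[>] (0 : ℝ), δ ∈ Ioo 0 (min δ₀ (1 / 2)) :=
      Ioo_mem_nhdsGT (by positivity)
    obtain ⟨δ, h1, h2⟩ := (h1.and h2).exists
    exact ⟨δ, h2.1, (h2.2.trans_le (min_le_left _ _)).le, (h2.2.trans_le (min_le_right _ _)).le,
      h1.le⟩
  have hδ1 : δ ^ α ≤ 1 := Real.rpow_le_one hδ.le (by linarith) hα.le
  set E : ℝ := ((2 * δ) ^ n)⁻¹
  have hE : 0 < E := by positivity
  have hsup : ∀ (φ : (Fin n → ℝ) → ℝ) (H : ℝ), Continuous φ → LatticePeriodic φ →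
      (∀ x, 0 ≤ φ x) → 0 ≤ H → (∀ x x', ‖x - x'‖ ≤ δ₀ → |φ x - φ x'| ≤ H * ‖x - x'‖ ^ α) →
      ∀ y, φ y ≤ E * (∫ x in unitCube 0, φ x) + H * δ ^ α := by
    intro φ H hφc hφ hφ0 hH hφH y
    have := mul_pow_le_setIntegral_unitCube hφc hφ hφ0 hδ hδ2 y (m := φ y - H * δ ^ α)
      fun z hz => by
        have h1 := hφH y z (by rw [norm_sub_rev]; exact hz.le.trans hδδ)
        have h2 : ‖y - z‖ ^ α ≤ δ ^ α :=
          Real.rpow_le_rpow (norm_nonneg _) (by rw [norm_sub_rev]; exact hz.le) hα.le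
        have h3 := (le_abs_self _).trans (h1.trans (mul_le_mul_of_nonneg_left h2 hH))
        linarith
    rw [← le_div_iff₀ (by positivity), div_eq_inv_mul] at this
    linarith
  refine ⟨E + 2 * D * E, by positivity, N₀, fun φ H hφc hφ hφ0 hH hφH v hv j => ?_⟩
  set I := ∫ x in unitCube 0, φ x
  have hI : 0 ≤ I := integral_nonneg hφ0
  have hcont := h.continuous_transferIterate v hφc
  have hper := h.latticePeriodic_transferIterate v hφ
  have hnn : ∀ N y, 0 ≤ transferIterate G w R v (fun _ => 1) φ N y :=
    h.transferIterate_nonneg v (fun _ => zero_le_one) hφ0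
  have hgauge : ∀ j : ℕ, ∀ y y', ‖y - y'‖ ≤ δ₀ →
      |transferIterate G w R v (fun _ => 1) φ (j * N₀) y -
        transferIterate G w R v (fun _ => 1) φ (j * N₀) y'| ≤
          (H / 2 ^ j + 2 * D * E * I) * ‖y - y'‖ ^ α := by
    intro j
    induction j with
    | zero =>
      intro y y' _
      simp only [zero_mul, transferIterate, pow_zero, div_one]
      exact (hφH y y').trans (mul_le_mul_of_nonneg_right (le_add_of_nonneg_right (by positivity))
        (by positivity))
    | succ j ih =>
      intro y y' hy
      set H' := H / 2 ^ j + 2 * D * E * I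
      have hH' : 0 ≤ H' := by positivity
      have hS := hsup _ H' (hcont (j * N₀)) (hper _) (hnn _) hH' ih
      rw [h.setIntegral_transferIterate v hφc hφ] at hS
      have := hLY (fun i => v (j * N₀ + i)) _ H' _ hH'
        (fun x => by rw [abs_of_nonneg (hnn _ x)]; exact hS x) ih y y' hy
      rw [add_mul, one_mul, transferIterate_add]
      refine this.trans (mul_le_mul_of_nonneg_right ?_ (by positivity))
      have h1 : H' * transferIterate G w R (fun i => v (j * N₀ + i)) c (fun _ => 1) N₀ y ≤
          H' * (1 / 4) :=
        mul_le_mul_of_nonneg_left ((hdec _ (fun i => hv _) N₀ y).trans hN₀') hH'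
      have h2 : H' * (D * δ ^ α) ≤ H' * (1 / 4) := mul_le_mul_of_nonneg_left hδα hH'
      have h3 : H / 2 ^ (j + 1) = H / 2 ^ j / 2 := by rw [pow_succ]; field_simp
      have h4 : H' = H / 2 ^ j + 2 * D * E * I := rfl
      rw [h3]
      linarith
  intro y
  have hH' : 0 ≤ H / 2 ^ j + 2 * D * E * I := by positivity
  have := hsup _ _ (hcont (j * N₀)) (hper _) (hnn _) hH' (hgauge j) y
  rw [h.setIntegral_transferIterate v hφc hφ] at this
  have h1 := mul_le_mul_of_nonneg_left hδ1 hH'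
  linarith

end BranchSystem

theorem tproj_add {n : ℕ} (x y : Fin n → ℝ) : tproj n (x + y) = tproj n x + tproj n y := by
  funext i; simp [tproj]

theorem tproj_sub {n : ℕ} (x y : Fin n → ℝ) : tproj n (x - y) = tproj n x - tproj n y := by
  funext i; simp [tproj]

@[simp] theorem tproj_intVec {n : ℕ} (l : Fin n → ℤ) : tproj n (intVec n l) = 0 := by
  funext i
  simp [tproj]

theorem tproj_add_intVec {n : ℕ} (x : Fin n → ℝ) (l : Fin n → ℤ) :
    tproj n (x + intVec n l) = tproj n x := by
  rw [tproj_add, tproj_intVec, add_zero]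

theorem tproj_surjective (n : ℕ) : Function.Surjective (tproj n) := fun p => by
  choose x hx using fun i => QuotientAddGroup.mk_surjective (p i)
  exact ⟨x, funext hx⟩

theorem continuous_tproj (n : ℕ) : Continuous (tproj n) :=
  continuous_pi fun i => (AddCircle.continuous_mk' 1).comp (continuous_apply i)

theorem exists_norm_sub_intVec_le {n : ℕ} (x : Fin n → ℝ) :
    ∃ l, ‖x - intVec n l‖ ≤ ‖tproj n x‖ := by
  refine ⟨fun i => round (x i), (pi_norm_le_iff_of_nonneg (norm_nonneg _)).2 fun i => ?_⟩
  have h1 : ‖((x i : ℝ) : AddCircle (1 : ℝ))‖ = |x i - round (x i)| := by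
    simpa using AddCircle.norm_eq (1 : ℝ) (x := x i)
  exact h1.symm.le.trans (norm_le_pi_norm (tproj n x) i)

theorem norm_tproj_le {n : ℕ} (x : Fin n → ℝ) : ‖tproj n x‖ ≤ ‖x‖ := by
  refine (pi_norm_le_iff_of_nonneg (norm_nonneg _)).2 fun i => ?_
  have h1 : ‖((x i : ℝ) : AddCircle (1 : ℝ))‖ = |x i - round (x i)| := by
    simpa using AddCircle.norm_eq (1 : ℝ) (x := x i)
  have h2 : |x i - round (x i)| ≤ |x i| := by simpa using round_le (x i) 0
  exact (h1.trans_le h2).trans (norm_le_pi_norm x i)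

theorem eq_zero_of_norm_intVec_lt_one {n : ℕ} {l : Fin n → ℤ} (hl : ‖intVec n l‖ < 1) : l = 0 := by
  funext i
  have h1 : |(l i : ℝ)| < 1 := (norm_le_pi_norm (intVec n l) i).trans_lt hl
  exact Int.abs_lt_one_iff.1 (by exact_mod_cast h1)

namespace BranchSystem

variable {n : ℕ} {F G : (Fin n → ℝ) → Fin n → ℝ} {w : (Fin n → ℝ) → ℝ}
    {A : (Fin n → ℤ) →+ (Fin n → ℤ)} {R : Finset (Fin n → ℤ)}

/-- Two preimages of a point that are close on the torus come from the same branch. -/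
theorem branch_eq (h : BranchSystem F G w A R) {L ρ : ℝ} (hL0 : 0 ≤ L)
    (hL : ∀ x x', ‖F x - F x'‖ ≤ L * ‖x - x'‖) (hρL : 2 * ρ * L < 1) {p : Torus n}
    {z : Fin n → ℝ} {k k' : Fin n → ℤ} (hk : k ∈ R) (hk' : k' ∈ R)
    (hp : ‖tproj n (G (z + intVec n k)) - p‖ < ρ) (hp' : ‖tproj n (G (z + intVec n k')) - p‖ < ρ) :
    k = k' := by
  obtain ⟨l, hl⟩ := exists_norm_sub_intVec_le (G (z + intVec n k) - G (z + intVec n k'))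
  have h1 : ‖G (z + intVec n k) - (G (z + intVec n k') + intVec n l)‖ ≤ 2 * ρ := by
    rw [← sub_sub]
    refine hl.trans ?_
    rw [tproj_sub, ← sub_sub_sub_cancel_right _ _ p]
    linarith [norm_sub_le (tproj n (G (z + intVec n k)) - p) (tproj n (G (z + intVec n k')) - p)]
  have h2 : k - (k' + A l) = 0 := by
    refine eq_zero_of_norm_intVec_lt_one (lt_of_le_of_lt ?_ hρL)
    have := hL (G (z + intVec n k)) (G (z + intVec n k') + intVec n l)
    rw [h.F_add, h.F_G, h.F_G, add_assoc, add_sub_add_left_eq_sub, ← map_add, ← map_sub] at this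
    refine this.trans ?_
    rw [mul_comm]
    exact mul_le_mul_of_nonneg_right h1 hL0
  obtain ⟨m, -, hm⟩ := h.existsUnique_rep k'
  have h3 : l = m := hm l (by
    show k' + A l ∈ R
    rwa [← sub_eq_zero.1 h2])
  have h4 : 0 = m := hm 0 (by simpa using hk')
  rw [sub_eq_zero.1 h2, h3, ← h4, map_zero, add_zero]

open scoped Classical in
/-- Decay for a weight that is small away from a neighbourhood of a finite set. -/
theorem exists_transferDecay (h : BranchSystem F G w A R) {f : Torus n → Torus n}
    (hlift : ∀ x, f (tproj n x) = tproj n (F x)) {L ρ ε τ : ℝ} (hL0 : 0 ≤ L)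
    (hL : ∀ x x', ‖F x - F x'‖ ≤ L * ‖x - x'‖) (hρL : 2 * ρ * L < 1) (hτ0 : 0 < τ) (hτ1 : τ < 1)
    (hwτ : ∀ y, w y ≤ τ) (K : Finset (Torus n))
    (hsep : ∀ p ∈ K, ∀ q ∈ K, ‖f p - q‖ < L * ρ + ε + ρ → f p = q) :
    ∃ t₀ > 0, t₀ ≤ 1 ∧ ∀ t, 0 < t → t ≤ t₀ →
      TransferDecay G w R ε fun x => if ∃ p ∈ K, ‖tproj n x - p‖ < ρ then 1 else t := by
  set η : ℝ := (1 - τ) / 2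
  set r : ℝ := (1 + τ) / 2
  set κ : ℝ := (K.card : ℝ)
  set d : ℝ := (R.card : ℝ)
  have hη : 0 < η := by simp only [η]; linarith
  have hr : 0 < r := by simp only [r]; linarith
  have hκ : 0 ≤ κ := Nat.cast_nonneg _
  have hd : 0 ≤ d := Nat.cast_nonneg _
  refine ⟨min 1 (r * η / ((κ + η) * (d + 1))), by positivity, min_le_left _ _,
    fun t ht htt => ?_⟩
  have htη : (κ + η) * (d * t) ≤ r * η := by
    have := htt.trans (min_le_right _ _)
    rw [le_div_iff₀ (by positivity)] at this
    nlinarith [mul_pos (show 0 < κ + η by positivity) ht]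
  set c : (Fin n → ℝ) → ℝ := fun x => if ∃ p ∈ K, ‖tproj n x - p‖ < ρ then 1 else t with hc
  have hc0 : ∀ x, 0 ≤ c x := by
    intro x; simp only [hc]; split_ifs <;> positivity
  refine ⟨(κ + η) / η, by positivity, r, hr, by simp only [r]; linarith, fun v hv => ?_⟩
  set T := transferIterate G w R v c (fun _ => 1)
  have hT0 : ∀ N y, 0 ≤ T N y := h.transferIterate_nonneg v hc0 fun _ => zero_le_one
  have key : ∀ N, ∃ (a : Torus n → ℝ) (W : ℝ), (∀ p, 0 ≤ a p) ∧ 0 ≤ W ∧ (∀ y, T N y ≤ W) ∧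
      (∀ p ∈ K, ∀ y, ‖tproj n y - p‖ < ρ → T N y ≤ a p) ∧
      ∑ p ∈ K, a p + η * W ≤ (κ + η) * r ^ N := by
    intro N
    induction N with
    | zero =>
      exact ⟨fun _ => 1, 1, fun _ => zero_le_one, zero_le_one, fun _ => le_rfl,
        fun _ _ _ _ => le_rfl, by simp [κ]⟩
    | succ N ih =>
      obtain ⟨a, W, ha, hW, hTW, hTa, hsum⟩ := ih
      have hpt : ∀ x, c x * T N x ≤ t * W + ∑ p ∈ K, if ‖tproj n x - p‖ < ρ then a p else 0 := by
        intro x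
        have hnn : ∀ p ∈ K, 0 ≤ if ‖tproj n x - p‖ < ρ then a p else 0 := fun p _ => by
          split_ifs <;> simp [ha]
        simp only [hc]
        split_ifs with hx
        · obtain ⟨p, hp, hpx⟩ := hx
          have h1 := Finset.single_le_sum hnn hp
          rw [if_pos hpx] at h1
          have h2 := hTa p hp x hpx
          have h3 : 0 ≤ t * W := by positivity
          linarith
        · have h1 := Finset.sum_nonneg hnn
          have h2 := mul_le_mul_of_nonneg_left (hTW x) ht.le
          linarith
      have hcount : ∀ (z : Fin n → ℝ) (p : Torus n),
          ∑ k ∈ R, (if ‖tproj n (G (z + intVec n k)) - p‖ < ρ then a p else 0) ≤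
            if ∃ k ∈ R, ‖tproj n (G (z + intVec n k)) - p‖ < ρ then a p else 0 := by
        intro z p
        split_ifs with hex
        · obtain ⟨k, hk, hkp⟩ := hex
          rw [Finset.sum_eq_single_of_mem k hk, if_pos hkp]
          intro k' hk' hne
          rw [if_neg]
          exact fun hk'p => hne (h.branch_eq hL0 hL hρL hk' hk hk'p hkp)
        · refine (Finset.sum_eq_zero fun k hk => if_neg fun hkp => hex ⟨k, hk, hkp⟩).le
      have hstep : ∀ y, T (N + 1) y ≤ d * t * W + τ * ∑ p ∈ K,
          if ∃ k ∈ R, ‖tproj n (G (y - v N + intVec n k)) - p‖ < ρ then a p else 0 := by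
        intro y
        calc T (N + 1) y ≤ ∑ k ∈ R, τ * (t * W + ∑ p ∈ K,
              if ‖tproj n (G (y - v N + intVec n k)) - p‖ < ρ then a p else 0) := by
              refine Finset.sum_le_sum fun k _ => ?_
              exact mul_le_mul (hwτ _) (hpt _) (mul_nonneg (hc0 _) (hT0 _ _)) hτ0.le
          _ = τ * (d * t * W) + τ * ∑ p ∈ K, ∑ k ∈ R,
              if ‖tproj n (G (y - v N + intVec n k)) - p‖ < ρ then a p else 0 := by
              rw [← Finset.mul_sum, Finset.sum_add_distrib, Finset.sum_comm, Finset.sum_const,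
                nsmul_eq_mul]
              ring
          _ ≤ _ := by
              refine add_le_add (mul_le_of_le_one_left (by positivity) hτ1.le)
                (mul_le_mul_of_nonneg_left (Finset.sum_le_sum fun p _ => hcount _ p) hτ0.le)
      refine ⟨fun q => d * t * W + τ * ∑ p ∈ K, if f p = q then a p else 0,
        d * t * W + τ * ∑ p ∈ K, a p, fun q => ?_, ?_, fun y => ?_, fun q hq y hy => ?_, ?_⟩
      · have : 0 ≤ ∑ p ∈ K, if f p = q then a p else 0 :=
          Finset.sum_nonneg fun p _ => by split_ifs <;> simp [ha]
        positivity
      · have : 0 ≤ ∑ p ∈ K, a p := Finset.sum_nonneg fun p _ => ha p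
        positivity
      · refine (hstep y).trans ?_
        refine add_le_add le_rfl
          (mul_le_mul_of_nonneg_left (Finset.sum_le_sum fun p _ => ?_) hτ0.le)
        split_ifs
        exacts [le_rfl, ha p]
      · refine (hstep y).trans ?_
        refine add_le_add le_rfl
          (mul_le_mul_of_nonneg_left (Finset.sum_le_sum fun p hp => ?_) hτ0.le)
        split_ifs with h1 h2 h2
        · exact le_rfl
        · refine absurd (hsep p hp q hq ?_) h2
          obtain ⟨k, hk, hkp⟩ := h1
          set x := G (y - v N + intVec n k) with hx
          obtain ⟨x', rfl⟩ := tproj_surjective n p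
          rw [← tproj_sub] at hkp
          obtain ⟨l, hl⟩ := exists_norm_sub_intVec_le (x - x')
          have e1 : tproj n (x' + intVec n l) = tproj n x' := tproj_add_intVec _ _
          have e2 : tproj n (F x) = tproj n y - tproj n (v N) := by
            rw [hx, h.F_G, tproj_add_intVec, tproj_sub]
          have h3 : ‖f (tproj n x') - tproj n (F x)‖ ≤ L * ρ := by
            rw [← e1, hlift, ← tproj_sub]
            refine (norm_tproj_le _).trans ((hL _ _).trans (mul_le_mul_of_nonneg_left ?_ hL0))
            rw [norm_sub_rev, ← sub_sub]
            exact hl.trans hkp.le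
          have h4 : ‖tproj n (v N)‖ ≤ ε := (norm_tproj_le _).trans (hv N)
          calc ‖f (tproj n x') - q‖
              = ‖(f (tproj n x') - tproj n (F x)) - tproj n (v N) + (tproj n y - q)‖ := by
                rw [e2]; congr 1; abel
            _ ≤ ‖f (tproj n x') - tproj n (F x)‖ + ‖tproj n (v N)‖ + ‖tproj n y - q‖ :=
                (norm_add_le _ _).trans (add_le_add_left (norm_sub_le _ _) _)
            _ < _ := by linarith
        · exact ha p
        · exact le_rfl
      · have h1 : ∑ q ∈ K, ∑ p ∈ K, (if f p = q then a p else 0) ≤ ∑ p ∈ K, a p := by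
          rw [Finset.sum_comm]
          refine Finset.sum_le_sum fun p _ => ?_
          rw [Finset.sum_ite_eq]
          split_ifs
          exacts [le_rfl, ha p]
        have h2 : 0 ≤ ∑ p ∈ K, a p := Finset.sum_nonneg fun p _ => ha p
        rw [Finset.sum_add_distrib, Finset.sum_const, nsmul_eq_mul, ← Finset.mul_sum]
        have h3 := mul_le_mul_of_nonneg_left h1 hτ0.le
        have h4 := mul_le_mul_of_nonneg_right htη hW
        have h5 : τ * (1 + η) ≤ r := by simp only [η, r]; nlinarith
        have h6 := mul_le_mul_of_nonneg_right h5 h2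
        have h7 := mul_le_mul_of_nonneg_left hsum hr.le
        rw [pow_succ]
        change κ * (d * t * W) + _ + _ ≤ _
        linarith
  intro N y
  obtain ⟨a, W, ha, hW, hTW, -, hsum⟩ := key N
  refine (hTW y).trans ?_
  have h2 : 0 ≤ ∑ p ∈ K, a p := Finset.sum_nonneg fun p _ => ha p
  rw [div_mul_eq_mul_div, le_div_iff₀ hη]
  linarith

open scoped Classical in
theorem transferDecay_of_lt_one (h : BranchSystem F G w A R) {f : Torus n → Torus n}
    (hlift : ∀ x, f (tproj n x) = tproj n (F x)) {L ρ ε τ w₀ : ℝ} (hL0 : 0 ≤ L)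
    (hL : ∀ x x', ‖F x - F x'‖ ≤ L * ‖x - x'‖) (hρL : 2 * ρ * L < 1) (hτ0 : 0 < τ) (hτ1 : τ < 1)
    (hwτ : ∀ y, w y ≤ τ) (hw : UniformContinuous w) (hw₀ : 0 < w₀) (hw₀w : ∀ y, w₀ ≤ w y)
    (K : Finset (Torus n)) (hsep : ∀ p ∈ K, ∀ q ∈ K, ‖f p - q‖ < L * ρ + ε + ρ → f p = q)
    {t : ℝ} (ht0 : 0 < t) (ht1 : t < 1) :
    TransferDecay G w R ε fun x => if ∃ p ∈ K, ‖tproj n x - p‖ < ρ then 1 else t := by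
  obtain ⟨t₀, ht₀, -, hdec⟩ := h.exists_transferDecay hlift hL0 hL hρL hτ0 hτ1 hwτ K hsep
  obtain ⟨m, hm⟩ := exists_pow_lt_of_lt_one ht₀ ht1
  have hm' : t ^ 2 ^ m ≤ t₀ :=
    (pow_le_pow_of_le_one ht0.le ht1.le Nat.lt_two_pow_self.le).trans hm.le
  clear hm ht1
  induction m generalizing t with
  | zero => exact hdec t ht0 (by simpa using hm')
  | succ m ih =>
    refine TransferDecay.of_sq h hw hw₀ hw₀w ?_
    have := ih (t := t ^ 2) (by positivity) (by rwa [← pow_mul, ← pow_succ'])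
    simpa only [ite_pow, one_pow] using this

end BranchSystem

theorem exists_inverse_hasFDerivAt {E : Type*} [NormedAddCommGroup E] [NormedSpace ℝ E]
    [CompleteSpace E] {F : E → E} (hF : Differentiable ℝ F)
    (huc : UniformContinuous (fderiv ℝ F)) (hunit : ∀ x, IsUnit (fderiv ℝ F x))
    (hinv : ∀ x, ‖Ring.inverse (fderiv ℝ F x)‖ ≤ 1) :
    ∃ G : E → E, (∀ y, F (G y) = y) ∧ (∀ x, G (F x) = x) ∧
      ∀ y, HasFDerivAt G (Ring.inverse (fderiv ℝ F (G y))) y := by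
  let Φ := Equiv.ofBijective F (bijective_of_norm_inverse_fderiv_le hF huc hunit hinv)
  let e : E → (E ≃L[ℝ] E) := fun x => ContinuousLinearEquiv.ofUnit (hunit x).unit
  have hes : ∀ x, (((e x).symm : E ≃L[ℝ] E) : E →L[ℝ] E) = Ring.inverse (fderiv ℝ F x) := by
    intro x
    conv_rhs => rw [← (hunit x).unit_spec, Ring.inverse_unit]
    rfl
  have he : ∀ x, HasFDerivAt F (e x : E →L[ℝ] E) x := fun x => (hF x).hasFDerivAt
  have hopen : IsOpenMap F := isOpenMap_of_hasStrictFDerivAt_equiv (f' := e) fun x =>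
    hasStrictFDerivAt_of_hasFDerivAt_of_continuousAt (f' := fderiv ℝ F)
      (Eventually.of_forall fun z => (hF z).hasFDerivAt) huc.continuous.continuousAt
  have hGc : Continuous Φ.symm :=
    (Φ.toHomeomorphOfContinuousOpen hF.continuous hopen).symm.continuous
  refine ⟨Φ.symm, Φ.apply_symm_apply, Φ.symm_apply_apply, fun y => ?_⟩
  rw [← hes]
  exact HasFDerivAt.of_local_left_inverse hGc.continuousAt (he _)
    (Eventually.of_forall Φ.apply_symm_apply)

theorem norm_ringInverse_sub_le {A : Type*} [NormedRing A] {a b : A} (ha : IsUnit a) (hb : IsUnit b)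
    (ha1 : ‖Ring.inverse a‖ ≤ 1) (hb1 : ‖Ring.inverse b‖ ≤ 1) :
    ‖Ring.inverse a - Ring.inverse b‖ ≤ ‖a - b‖ := by
  have : Ring.inverse a - Ring.inverse b = Ring.inverse a * (b - a) * Ring.inverse b := by
    rw [mul_sub, sub_mul, Ring.inverse_mul_cancel _ ha, mul_assoc, Ring.mul_inverse_cancel _ hb,
      mul_one, one_mul]
  rw [this]
  calc _ ≤ ‖Ring.inverse a‖ * ‖b - a‖ * ‖Ring.inverse b‖ := norm_mul₃_le
    _ ≤ 1 * ‖b - a‖ * 1 := by gcongr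
    _ = ‖a - b‖ := by rw [one_mul, mul_one, norm_sub_rev]

theorem ContinuousLinearMap.contDiff_det_pi (n : ℕ) :
    ContDiff ℝ 1 fun T : (Fin n → ℝ) →L[ℝ] (Fin n → ℝ) => T.det := by
  have : ∀ T : (Fin n → ℝ) →L[ℝ] (Fin n → ℝ), T.det =
      ∑ σ : Equiv.Perm (Fin n), (Equiv.Perm.sign σ : ℤ) • ∏ i, T (Pi.single i 1) (σ i) := by
    intro T
    rw [ContinuousLinearMap.det, ← LinearMap.det_toMatrix', Matrix.det_apply]
    simp [LinearMap.toMatrix'_apply, Units.smul_def]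
  simp only [this]
  refine ContDiff.sum fun σ _ => ContDiff.const_smul _ (contDiff_prod fun i _ => ?_)
  fun_prop

theorem ContinuousLinearMap.abs_det_le_norm_pow {n : ℕ} (T : (Fin n → ℝ) →L[ℝ] (Fin n → ℝ)) :
    |T.det| ≤ ‖T‖ ^ n := by
  have h1 : T '' Metric.closedBall 0 1 ⊆ Metric.closedBall 0 ‖T‖ := by
    rintro _ ⟨x, hx, rfl⟩
    rw [mem_closedBall_zero_iff] at hx ⊢
    exact T.le_of_opNorm_le_of_le le_rfl hx |>.trans_eq (mul_one _)
  have h2 := measure_mono (μ := volume) h1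
  rw [Measure.addHaar_image_continuousLinearMap, Real.volume_pi_closedBall _ zero_le_one,
    Real.volume_pi_closedBall _ (norm_nonneg _), ← ENNReal.ofReal_mul (abs_nonneg _),
    ENNReal.ofReal_le_ofReal_iff (by positivity), Fintype.card_fin, mul_pow, mul_pow, one_pow,
    mul_one, mul_comm, mul_le_mul_iff_right₀ (by positivity)] at h2
  exact h2

namespace LatticePeriodic

theorem exists_mem_Icc {n : ℕ} (x : Fin n → ℝ) : ∃ l, x + intVec n l ∈ Icc (0 : Fin n → ℝ) 1 := by
  obtain ⟨l, hl, -⟩ := existsUnique_add_mem_unitCube 0 x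
  exact ⟨l, fun i => (hl i (mem_univ i)).1, fun i => by simpa using (hl i (mem_univ i)).2.le⟩

theorem exists_forall_le {n : ℕ} {φ : (Fin n → ℝ) → ℝ} (hφc : Continuous φ)
    (hφ : LatticePeriodic φ) : ∃ x₀, ∀ x, φ x ≤ φ x₀ := by
  obtain ⟨x₀, -, h⟩ := (isCompact_Icc (a := (0 : Fin n → ℝ)) (b := 1)).exists_isMaxOn
    (nonempty_Icc.2 zero_le_one) hφc.continuousOn
  refine ⟨x₀, fun x => ?_⟩
  obtain ⟨l, hl⟩ := exists_mem_Icc x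
  rw [← hφ x l]
  exact h hl

/-- A continuous periodic function less than one on a closed periodic set is uniformly so. -/
theorem exists_lt_one {n : ℕ} {φ : (Fin n → ℝ) → ℝ} (hφc : Continuous φ) (hφ : LatticePeriodic φ)
    {s : Set (Fin n → ℝ)} (hs : IsClosed s) (hsp : ∀ x ∈ s, ∀ l, x + intVec n l ∈ s)
    (h1 : ∀ x ∈ s, φ x < 1) : ∃ κ, 0 < κ ∧ κ < 1 ∧ ∀ x ∈ s, φ x ≤ κ := by
  have hc := (isCompact_Icc (a := (0 : Fin n → ℝ)) (b := 1)).inter_right hs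
  rcases (Icc (0 : Fin n → ℝ) 1 ∩ s).eq_empty_or_nonempty with he | hne
  · refine ⟨1 / 2, by norm_num, by norm_num, fun x hx => ?_⟩
    obtain ⟨l, hl⟩ := exists_mem_Icc x
    exact absurd (⟨x + intVec n l, hl, hsp x hx l⟩ : (Icc (0 : Fin n → ℝ) 1 ∩ s).Nonempty)
      (not_nonempty_iff_eq_empty.2 he)
  · obtain ⟨x₀, hx₀, h⟩ := hc.exists_isMaxOn hne hφc.continuousOn
    refine ⟨max (1 / 2) (φ x₀), by positivity, max_lt (by norm_num) (h1 _ hx₀.2), fun x hx => ?_⟩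
    obtain ⟨l, hl⟩ := exists_mem_Icc x
    rw [← hφ x l]
    exact (h ⟨hl, hsp x hx l⟩).trans (le_max_right _ _)

end LatticePeriodic

theorem exists_intVec_of_tproj_eq {n : ℕ} {x y : Fin n → ℝ} (h : tproj n x = tproj n y) :
    ∃ l, x = y + intVec n l := by
  obtain ⟨l, hl⟩ := exists_norm_sub_intVec_le (x - y)
  rw [tproj_sub, h, sub_self, norm_zero, norm_le_zero_iff, sub_sub, sub_eq_zero] at hl
  exact ⟨l, hl⟩

/-- The action on the lattice of a lift of a torus map. -/
theorem exists_lattice_hom {n : ℕ} {f : Torus n → Torus n} {F : (Fin n → ℝ) → Fin n → ℝ}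
    (hF : Continuous F) (hlift : ∀ x, f (tproj n x) = tproj n (F x)) :
    ∃ A : (Fin n → ℤ) →+ (Fin n → ℤ), ∀ x l, F (x + intVec n l) = F x + intVec n (A l) := by
  have h1 : ∀ x l, ∃ m, F (x + intVec n l) = F x + intVec n m := fun x l =>
    exists_intVec_of_tproj_eq (by rw [← hlift, ← hlift, tproj_add_intVec])
  choose m hm using h1
  have hconst : ∀ l x y, m x l = m y l := by
    intro l x y
    have hc : Continuous fun x => m x l := by
      refine continuous_pi fun i => Int.isClosedEmbedding_coe_real.continuous_iff.2 ?_
      have : ((fun j : ℤ => (j : ℝ)) ∘ fun x => m x l i) =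
          fun x => F (x + intVec n l) i - F x i := by
        funext x
        simp [hm]
      rw [this]
      fun_prop
    exact PreconnectedSpace.constant inferInstance hc
  refine ⟨AddMonoidHom.mk' (m 0) fun a b => intVec_injective n ?_, fun x l => ?_⟩
  · have h2 := hm 0 (a + b)
    rw [map_add, ← add_assoc, hm, hm, hconst b _ 0, add_assoc] at h2
    rw [map_add, add_left_cancel h2]
  · rw [hm, hconst l x 0]; rfl

theorem exists_separation {X : Type*} [NormedAddCommGroup X] (K : Finset X) (f : X → X) :
    ∃ η > 0, ∀ p ∈ K, ∀ q ∈ K, ‖f p - q‖ < η → f p = q := by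
  have h : ∀ᶠ η in 𝓝[>] (0 : ℝ), ∀ p ∈ K, ∀ q ∈ K, ‖f p - q‖ < η → f p = q := by
    refine (Finset.eventually_all K).2 fun p _ => (Finset.eventually_all K).2 fun q _ => ?_
    by_cases hpq : f p = q
    · exact Eventually.of_forall fun _ _ => hpq
    · have : 0 < ‖f p - q‖ := norm_sub_pos_iff.2 hpq
      filter_upwards [Ioo_mem_nhdsGT this] with η hη h
      exact absurd h hη.2.not_gt
  obtain ⟨η, h1, h2⟩ := (h.and self_mem_nhdsWithin).exists
  exact ⟨η, h2, h1⟩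

namespace TorusHyp

variable {n : ℕ} {α : ℝ} {f : Torus n → Torus n} {F : (Fin n → ℝ) → Fin n → ℝ}

theorem uniformContinuous_fderiv (hyp : TorusHyp n α f F) : UniformContinuous (fderiv ℝ F) := by
  obtain ⟨C, hC⟩ := hyp.hHolder
  have : HolderWith C.toNNReal α.toNNReal (fderiv ℝ F) := by
    intro x y
    rw [edist_dist, edist_dist, ← ENNReal.ofReal_coe_nnreal, Real.coe_toNNReal α hyp.hα0.le,
      ENNReal.ofReal_rpow_of_nonneg dist_nonneg hyp.hα0.le, ← ENNReal.ofReal_mul (by simp)]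
    refine ENNReal.ofReal_le_ofReal ?_
    rw [dist_eq_norm, dist_eq_norm]
    exact (hC x y).trans (mul_le_mul_of_nonneg_right (Real.le_coe_toNNReal C) (by positivity))
  exact this.uniformContinuous (Real.toNNReal_pos.2 hyp.hα0)

theorem one_lt_abs_det (hyp : TorusHyp n α f F) (hdet : ∀ x ∈ KsetF n F, 1 < |(fderiv ℝ F x).det|)
    (x : Fin n → ℝ) : 1 < |(fderiv ℝ F x).det| := by
  by_cases hx : x ∈ KsetF n F
  · exact hdet x hx
  have h1 : ‖Ring.inverse (fderiv ℝ F x)‖ < 1 := lt_of_le_of_ne (hyp.hinvnorm x) hx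
  have h2 := (ContinuousLinearMap.abs_det_le_norm_pow (Ring.inverse (fderiv ℝ F x))).trans_lt
    (pow_lt_one₀ (norm_nonneg _) h1 (by have := hyp.hn; omega))
  have h3 : |(Ring.inverse (fderiv ℝ F x)).det| * |(fderiv ℝ F x).det| = 1 := by
    have h4 := congrArg (fun T : (Fin n → ℝ) →L[ℝ] (Fin n → ℝ) => LinearMap.det T.toLinearMap)
      (Ring.inverse_mul_cancel _ (hyp.hunit x))
    simp only [ContinuousLinearMap.toLinearMap_mul, map_mul, ContinuousLinearMap.toLinearMap_one,
      map_one] at h4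
    rw [← abs_mul, ContinuousLinearMap.det, ContinuousLinearMap.det, h4, abs_one]
  by_contra hle
  have := mul_lt_mul_of_nonneg_of_pos h2 (not_lt.1 hle) (abs_nonneg _) one_pos
  linarith


theorem exists_branchSystem (hyp : TorusHyp n α f F)
    (hdet : ∀ x ∈ KsetF n F, 1 < |(fderiv ℝ F x).det|) :
    ∃ G w A R, BranchSystem F G w A R ∧ ∃ ε > 0, ∃ C > 0, ∃ N₀ : ℕ,
      ∀ (φ : (Fin n → ℝ) → ℝ) (H : ℝ), Continuous φ → LatticePeriodic φ → (∀ x, 0 ≤ φ x) →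
        0 ≤ H → (∀ x x', |φ x - φ x'| ≤ H * ‖x - x'‖ ^ α) →
        ∀ v : ℕ → Fin n → ℝ, (∀ i, ‖v i‖ ≤ ε) → ∀ (j : ℕ) y,
          transferIterate G w R v (fun _ => 1) φ (j * N₀) y ≤
            C * (∫ x in unitCube 0, φ x) + H / 2 ^ j := by
  classical
  have huc := hyp.uniformContinuous_fderiv
  have hDc : Continuous (fderiv ℝ F) := huc.continuous
  obtain ⟨CH, hCH⟩ := hyp.hHolder
  obtain ⟨G, hFG, hGF, hGd⟩ := exists_inverse_hasFDerivAt hyp.hdiff huc hyp.hunit hyp.hinvnorm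
  obtain ⟨A, hA⟩ := exists_lattice_hom hyp.hdiff.continuous hyp.hlift
  have hDper : ∀ x l, fderiv ℝ F (x + intVec n l) = fderiv ℝ F x := by
    intro x l
    rw [← fderiv_comp_add_right]
    simp only [hA, fderiv_add_const]
  have hG1 : ∀ y y', ‖G y - G y'‖ ≤ ‖y - y'‖ := by
    intro y y'
    simpa using convex_univ.norm_image_sub_le_of_norm_hasFDerivWithin_le
      (fun z _ => (hGd z).hasFDerivWithinAt) (fun z _ => hyp.hinvnorm (G z)) (mem_univ y')
      (mem_univ y)
  have hGc : Continuous G := continuous_iff_continuousAt.2 fun y => (hGd y).continuousAt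
  -- bounds for the Jacobian
  set J : (Fin n → ℝ) → ℝ := fun x => |(fderiv ℝ F x).det| with hJ
  have hJc : Continuous J := (ContinuousLinearMap.continuous_det.comp hDc).abs
  have hJp : LatticePeriodic J := fun x l => by simp only [hJ, hDper]
  have hJ1 : ∀ x, 1 < J x := hyp.one_lt_abs_det hdet
  obtain ⟨M, hM⟩ : ∃ M, ∀ x, ‖fderiv ℝ F x‖ ≤ M := by
    obtain ⟨x₀, hx₀⟩ := LatticePeriodic.exists_forall_le (φ := fun x => ‖fderiv ℝ F x‖)
      hDc.norm fun x l => by simp only [hDper]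
    exact ⟨_, hx₀⟩
  have hM0 : 0 ≤ M := (norm_nonneg _).trans (hM 0)
  have hL : ∀ x x', ‖F x - F x'‖ ≤ M * ‖x - x'‖ := fun x x' =>
    convex_univ.norm_image_sub_le_of_norm_hasFDerivWithin_le
      (fun z _ => (hyp.hdiff z).hasFDerivAt.hasFDerivWithinAt) (fun z _ => hM z) (mem_univ x')
      (mem_univ x)
  set w : (Fin n → ℝ) → ℝ := fun y => (J (G y))⁻¹ with hw
  have hJne : ∀ x, J x ≠ 0 := fun x => by linarith [hJ1 x]
  have hwc : Continuous w := (hJc.comp hGc).inv₀ fun _ => hJne _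
  obtain ⟨τ, hτ0, hτ1, hτ⟩ := LatticePeriodic.exists_lt_one (φ := fun x => (J x)⁻¹)
    (hJc.inv₀ hJne) (fun x l => by simp only [hJp x l]) isClosed_univ (fun _ _ _ => mem_univ _)
    fun x _ => inv_lt_one_of_one_lt₀ (hJ1 x)
  have hwτ : ∀ y, w y ≤ τ := fun y => hτ (G y) (mem_univ _)
  obtain ⟨xJ, hxJ⟩ := LatticePeriodic.exists_forall_le hJc hJp
  have hw₀ : 0 < (J xJ)⁻¹ := inv_pos.2 (by linarith [hJ1 xJ])
  have hw₀w : ∀ y, (J xJ)⁻¹ ≤ w y := fun y =>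
    inv_anti₀ (by linarith [hJ1 (G y)]) (hxJ _)
  -- Hölder continuity of the weight
  obtain ⟨Cw, hCw0, hwH⟩ : ∃ Cw, 0 ≤ Cw ∧ ∀ y y', |w y - w y'| ≤ Cw * ‖y - y'‖ ^ α := by
    have : ProperSpace ((Fin n → ℝ) →L[ℝ] (Fin n → ℝ)) := FiniteDimensional.proper ℝ _
    obtain ⟨Cd, hCd⟩ := (ContinuousLinearMap.contDiff_det_pi n).contDiffOn.exists_lipschitzOnWith
      one_ne_zero (convex_closedBall 0 M) (isCompact_closedBall 0 M)
    have hCH0 : 0 ≤ CH := by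
      have h1 := (norm_nonneg _).trans (hCH 0 fun _ => 1)
      have h2 : (0 : ℝ) < ‖(0 : Fin n → ℝ) - fun _ => 1‖ := by
        have : Nonempty (Fin n) := ⟨⟨0, hyp.hn⟩⟩
        simp
      exact nonneg_of_mul_nonneg_left h1 (Real.rpow_pos_of_pos h2 α)
    refine ⟨Cd * CH, by positivity, fun y y' => ?_⟩
    have h1 : |J (G y') - J (G y)| ≤ Cd * (CH * ‖y - y'‖ ^ α) := by
      refine (abs_abs_sub_abs_le _ _).trans ?_
      have h2 := hCd.dist_le_mul (fderiv ℝ F (G y')) (by simpa using hM _) (fderiv ℝ F (G y))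
        (by simpa using hM _)
      rw [dist_eq_norm, dist_eq_norm, norm_sub_rev (fderiv ℝ F (G y'))] at h2
      refine h2.trans (mul_le_mul_of_nonneg_left ((hCH _ _).trans ?_) Cd.coe_nonneg)
      exact mul_le_mul_of_nonneg_left (Real.rpow_le_rpow (norm_nonneg _) (hG1 _ _) hyp.hα0.le) hCH0
    rw [hw, inv_sub_inv (hJne _) (hJne _), abs_div, mul_assoc]
    refine (div_le_self (abs_nonneg _) ?_).trans h1
    rw [abs_mul]
    exact one_le_mul_of_one_le_of_one_le ((hJ1 _).le.trans (le_abs_self _))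
      ((hJ1 _).le.trans (le_abs_self _))
  have hwu : UniformContinuous w := by
    rw [Metric.uniformContinuous_iff]
    intro e he
    have hlim : Tendsto (fun δ : ℝ => Cw * δ ^ α) (𝓝[>] 0) (𝓝 (Cw * 0 ^ α)) :=
      (((Real.continuousAt_rpow_const 0 α (Or.inr hyp.hα0.le)).tendsto).const_mul Cw).mono_left
        nhdsWithin_le_nhds
    rw [Real.zero_rpow hyp.hα0.ne', mul_zero] at hlim
    obtain ⟨δ, h1, h2⟩ := ((hlim.eventually_lt_const he).and self_mem_nhdsWithin).exists
    refine ⟨δ, h2, fun {y y'} hy => ?_⟩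
    rw [dist_eq_norm] at hy
    refine ((hwH y y').trans (mul_le_mul_of_nonneg_left ?_ hCw0)).trans_lt h1
    exact Real.rpow_le_rpow (norm_nonneg _) hy.le hyp.hα0.le
  -- the branches
  have hGA : ∀ y l, G (y + intVec n (A l)) = G y + intVec n l := by
    intro y l
    conv_lhs => rw [← hFG y]
    rw [← hA, hGF]
  have hRfin : {k : Fin n → ℤ | G (intVec n k) ∈ unitCube 0}.Finite := by
    obtain ⟨b, hb⟩ := ((isCompact_Icc (a := (0 : Fin n → ℝ)) (b := 1)).image
      hyp.hdiff.continuous).isBounded.subset_closedBall 0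
    refine (Set.finite_Icc (fun _ => -⌈b⌉) fun _ => ⌈b⌉).subset fun k hk => ?_
    have h1 : ‖intVec n k‖ ≤ b := by
      have : intVec n k ∈ F '' Icc 0 1 := ⟨G (intVec n k), ⟨fun i => (hk i (mem_univ i)).1,
        fun i => by simpa using (hk i (mem_univ i)).2.le⟩, hFG _⟩
      simpa using hb this
    have h2 : ∀ i, |(k i : ℝ)| ≤ b := fun i => (norm_le_pi_norm (intVec n k) i).trans h1
    have h3 : ∀ i, |k i| ≤ ⌈b⌉ := fun i => by
      have := (h2 i).trans (Int.le_ceil b)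
      exact_mod_cast this
    exact ⟨fun i => (abs_le.1 (h3 i)).1, fun i => (abs_le.1 (h3 i)).2⟩
  have hB : BranchSystem F G w A hRfin.toFinset :=
    { F_G := hFG
      G_F := hGF
      F_add := hA
      existsUnique_rep := fun k => by
        simpa only [Finite.mem_toFinset, mem_ofPred_eq, map_add, hGA] using
          existsUnique_add_mem_unitCube 0 (G (intVec n k))
      differentiable_F := hyp.hdiff
      w_mul_det := fun x => by
        simp only [hw, hGF]
        exact inv_mul_cancel₀ (hJne x)
      w_add := fun y l => by simp only [hw, hGA, hJp _ _]
      continuous_w := hwc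
      w_pos := fun y => hw₀.trans_le (hw₀w y)
      norm_G_sub_le := hG1 }
  -- geometry near the exceptional set
  set K : Finset (Torus n) := hyp.hKfin.toFinset
  obtain ⟨η, hη, hsep⟩ := exists_separation K f
  set ρ : ℝ := min 1 η / (4 * (M + 1))
  have hρ : 0 < ρ := by positivity
  have hρM : ρ * (M + 1) = min 1 η / 4 := by simp only [ρ]; field_simp
  have hρL : 2 * ρ * M < 1 := by nlinarith [min_le_left 1 η]
  have hsep' : ∀ p ∈ K, ∀ q ∈ K, ‖f p - q‖ < M * ρ + η / 2 + ρ → f p = q := fun p hp q hq h =>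
    hsep p hp q hq (by nlinarith [min_le_right 1 η])
  set s : Set (Fin n → ℝ) := {x | ∀ p ∈ K, ρ ≤ ‖tproj n x - p‖} with hs
  have hsc : IsClosed s := by
    simp only [hs, ofPred_forall]
    exact isClosed_biInter fun p _ =>
      isClosed_le continuous_const ((continuous_tproj n).sub continuous_const).norm
  have hinvc : Continuous fun x => ‖Ring.inverse (fderiv ℝ F x)‖ := by
    refine Continuous.norm (continuous_iff_continuousAt.2 fun x => ?_)
    have h1 := NormedRing.inverse_continuousAt (hyp.hunit x).unit
    rw [IsUnit.unit_spec] at h1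
    exact ContinuousAt.comp (f := fderiv ℝ F) h1 hDc.continuousAt
  obtain ⟨κ₀, hκ00, hκ01, hκ₀⟩ := LatticePeriodic.exists_lt_one hinvc
    (fun x l => by simp only [hDper]) hsc (fun x hx l => by
      simpa only [hs, mem_ofPred_eq, tproj_add_intVec] using hx)
    fun x hx => lt_of_le_of_ne (hyp.hinvnorm x) fun hx1 => by
      have := hx (tproj n x) (hyp.hKfin.mem_toFinset.2 ⟨x, hx1, rfl⟩)
      rw [sub_self, norm_zero] at this
      exact this.not_gt hρ
  set κ₁ : ℝ := (1 + κ₀) / 2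
  have hκ10 : 0 < κ₁ := by positivity
  have hκ11 : κ₁ < 1 := by simp only [κ₁]; linarith
  obtain ⟨δ₀, hδ₀, hδ₀D⟩ := Metric.uniformContinuous_iff.1 huc ((1 - κ₀) / 2) (by linarith)
  have hcontr : ∀ y y', ‖y - y'‖ ≤ δ₀ / 2 → G y ∈ s → ‖G y - G y'‖ ≤ κ₁ * ‖y - y'‖ := by
    intro y y' hy hys
    refine (convex_ball y δ₀).norm_image_sub_le_of_norm_hasFDerivWithin_le
      (fun z _ => (hGd z).hasFDerivWithinAt) (fun z hz => ?_) ?_ (Metric.mem_ball_self hδ₀)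
    · have h1 := norm_ringInverse_sub_le (hyp.hunit (G z)) (hyp.hunit (G y)) (hyp.hinvnorm _)
        (hyp.hinvnorm _)
      have h2 := hδ₀D (a := G z) (b := G y) (by
        rw [dist_eq_norm]
        exact (hG1 z y).trans_lt (mem_ball_iff_norm.1 hz))
      rw [dist_eq_norm] at h2
      have h3 := norm_le_norm_add_norm_sub' (Ring.inverse (fderiv ℝ F (G z)))
        (Ring.inverse (fderiv ℝ F (G y)))
      have h4 := hκ₀ _ hys
      simp only [κ₁]
      linarith
    · rw [mem_ball_iff_norm, norm_sub_rev]
      linarith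
  have ht0 : 0 < κ₁ ^ α := Real.rpow_pos_of_pos hκ10 α
  have ht1 : κ₁ ^ α < 1 := Real.rpow_lt_one hκ10.le hκ11 hyp.hα0
  have hdec := hB.transferDecay_of_lt_one hyp.hlift hM0 hL hρL hτ0 hτ1 hwτ hwu hw₀ hw₀w K hsep'
    ht0 ht1
  refine ⟨G, w, A, _, hB, η / 2, by positivity, ?_⟩
  refine hB.exists_transferIterate_le hyp.hα0 (half_pos hδ₀) hCw0 (fun y => (hwτ y).trans hτ1.le)
    hwH (fun x => ?_) (fun x => ?_) (fun y y' hy => ?_) hdec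
  · split_ifs <;> positivity
  · split_ifs
    exacts [le_rfl, ht1.le]
  · split_ifs with hx
    · rw [one_mul]
      exact Real.rpow_le_rpow (norm_nonneg _) (hG1 _ _) hyp.hα0.le
    · rw [← Real.mul_rpow hκ10.le (norm_nonneg _)]
      refine Real.rpow_le_rpow (norm_nonneg _) (hcontr y y' hy fun p hp => ?_) hyp.hα0.le
      by_contra hlt
      exact hx ⟨p, hp, not_le.1 hlt⟩

end TorusHyp

theorem measurePreserving_tproj_unitCube (n : ℕ) :
    MeasurePreserving (tproj n) (volume.restrict (unitCube 0)) volume := by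
  have h := measurePreserving_pi (fun _ : Fin n => (volume : Measure ℝ).restrict (Ioc 0 (0 + 1)))
    (fun _ => volume) fun _ => AddCircle.measurePreserving_mk 1 0
  rw [← Measure.restrict_pi_pi] at h
  have hae : (unitCube (0 : Fin n → ℝ) : Set _) =ᵐ[volume]
      Set.univ.pi fun _ : Fin n => Ioc (0 : ℝ) (0 + 1) := by
    exact Measure.pi_Ico_ae_eq_pi_Icc.trans Measure.pi_Ioc_ae_eq_pi_Icc.symm
  rw [Measure.restrict_congr_set hae]
  exact h

theorem isProbabilityMeasure_volume_torus (n : ℕ) :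
    IsProbabilityMeasure (volume : Measure (Torus n)) := by
  have : IsProbabilityMeasure (volume : Measure (AddCircle (1 : ℝ))) :=
    ⟨by simp [AddCircle.measure_univ]⟩
  exact inferInstanceAs (IsProbabilityMeasure (Measure.pi fun _ => volume))

theorem setIntegral_unitCube_comp_tproj {n : ℕ} {ψ : Torus n → ℝ} (hψ : Continuous ψ) :
    ∫ x in unitCube 0, ψ (tproj n x) = ∫ p, ψ p := by
  rw [← (measurePreserving_tproj_unitCube n).map_eq,
    integral_map (continuous_tproj n).aemeasurable hψ.aestronglyMeasurable]

theorem quasiMeasurePreserving_tproj (n : ℕ) :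
    Measure.QuasiMeasurePreserving (tproj n) volume volume := by
  refine ⟨(continuous_tproj n).measurable, Measure.AbsolutelyContinuous.mk fun s hs hs0 => ?_⟩
  rw [Measure.map_apply (continuous_tproj n).measurable hs]
  have h0 : volume (tproj n ⁻¹' s ∩ unitCube 0) = 0 := by
    have := (measurePreserving_tproj_unitCube n).measure_preimage hs.nullMeasurableSet
    rwa [Measure.restrict_apply ((continuous_tproj n).measurable hs), hs0] at this
  refine measure_mono_null (t := ⋃ l, (fun x => x + intVec n l) ⁻¹' (tproj n ⁻¹' s ∩ unitCube 0))
    (fun x hx => ?_) (measure_iUnion_null fun l => ?_)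
  · obtain ⟨l, hl, -⟩ := existsUnique_add_mem_unitCube 0 x
    exact mem_iUnion.2 ⟨l, by simpa [tproj_add_intVec] using hx, hl⟩
  · rw [measure_preimage_add_right, h0]

theorem TorusHyp.continuous {n : ℕ} {α : ℝ} {f : Torus n → Torus n} {F : (Fin n → ℝ) → Fin n → ℝ}
    (hyp : TorusHyp n α f F) : Continuous f := by
  have hq : IsOpenQuotientMap (tproj n) :=
    IsOpenQuotientMap.piMap fun _ => QuotientAddGroup.isOpenQuotientMap_mk
  rw [← hq.continuous_comp_iff, show f ∘ tproj n = tproj n ∘ F from funext hyp.hlift]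
  exact (continuous_tproj n).comp hyp.hdiff.continuous

theorem exists_lipschitz_approx {X : Type*} [PseudoMetricSpace X] [CompactSpace X] {g : X → ℝ}
    (hg : Continuous g) (hg0 : ∀ x, 0 ≤ g x) {δ : ℝ} (hδ : 0 < δ) :
    ∃ g' : X → ℝ, ∃ L ≥ 0, (∀ x, 0 ≤ g' x) ∧ (∀ x y, |g' x - g' y| ≤ L * dist x y) ∧
      ∀ x, |g x - g' x| ≤ δ := by
  obtain ⟨η, hη, hgη⟩ := Metric.uniformContinuous_iff.1
    (CompactSpace.uniformContinuous_of_continuous hg) δ hδ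
  obtain ⟨B, hB⟩ := (isCompact_range hg).bddAbove
  have hB' : ∀ x, g x ≤ B := fun x => hB (mem_range_self x)
  set L : ℝ := |B| / η
  have hL : 0 ≤ L := by positivity
  have hbdd : ∀ x, BddBelow (range fun y => g y + L * dist x y) := fun x =>
    ⟨0, by rintro _ ⟨y, rfl⟩; have := hg0 y; positivity⟩
  have hle : ∀ x x', ⨅ y, (g y + L * dist x y) ≤ (⨅ y, (g y + L * dist x' y)) + L * dist x x' := by
    intro x x'
    have : Nonempty X := ⟨x⟩
    rw [← sub_le_iff_le_add]
    refine le_ciInf fun y => ?_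
    have h1 := ciInf_le (hbdd x) y
    have h2 := mul_le_mul_of_nonneg_left (dist_triangle x x' y) hL
    linarith
  refine ⟨fun x => ⨅ y, (g y + L * dist x y), L, hL, fun x => Real.iInf_nonneg fun y => by
    have := hg0 y; positivity, fun x y => ?_, fun x => ?_⟩
  · have h1 := hle x y
    have h2 := hle y x
    rw [dist_comm y x] at h2
    rw [abs_le]
    constructor <;> linarith
  · have : Nonempty X := ⟨x⟩
    have h1 := ciInf_le (hbdd x) x
    have h2 : g x - δ ≤ ⨅ y, (g y + L * dist x y) := le_ciInf fun y => by
      rcases lt_or_ge (dist x y) η with h | h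
      · have := hgη h
        rw [Real.dist_eq, abs_lt] at this
        have : 0 ≤ L * dist x y := by positivity
        linarith
      · have h3 : |B| ≤ L * dist x y := by
          calc |B| = L * η := by simp only [L]; field_simp
            _ ≤ L * dist x y := by gcongr
        have := hB' x
        have := le_abs_self B
        have := hg0 y
        linarith
    simp only [dist_self, mul_zero, add_zero] at h1
    rw [abs_le]
    constructor <;> linarith

/-- The average of `ψ` over the images of a point under the randomly translated map. -/
def noiseAverage {n : ℕ} (f : Torus n → Torus n) (θ : Measure (Fin n → ℝ)) (ψ : Torus n → ℝ)
    (x : Torus n) : ℝ :=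
  ∫ v, ψ (f x + tproj n v) ∂θ

section NoiseAverage

variable {n : ℕ} {f : Torus n → Torus n} {θ : Measure (Fin n → ℝ)} [IsProbabilityMeasure θ]
  {ψ : Torus n → ℝ}

theorem continuous_noiseAverage (hf : Continuous f) (hψ : Continuous ψ) :
    Continuous (noiseAverage f θ ψ) := by
  obtain ⟨B, hB⟩ := isCompact_univ.exists_bound_of_continuousOn hψ.continuousOn
  have := continuous_tproj n
  refine continuous_of_dominated (bound := fun _ => B)
    (fun x => Continuous.aestronglyMeasurable (by fun_prop))
    (fun x => .of_forall fun v => hB _ (mem_univ _)) (integrable_const B)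
    (.of_forall fun v => by fun_prop)

theorem continuous_noiseAverage_iterate (hf : Continuous f) (hψ : Continuous ψ) (M : ℕ) :
    Continuous ((noiseAverage f θ)^[M] ψ) := by
  induction M with
  | zero => exact hψ
  | succ M ih =>
    rw [Function.iterate_succ_apply']
    exact continuous_noiseAverage hf ih

theorem norm_noiseAverage_iterate_le {B : ℝ} (hB : ∀ x, ‖ψ x‖ ≤ B) (M : ℕ) (x : Torus n) :
    ‖(noiseAverage f θ)^[M] ψ x‖ ≤ B := by
  induction M generalizing x with
  | zero => exact hB x
  | succ M ih =>
    rw [Function.iterate_succ_apply']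
    simpa [noiseAverage] using norm_integral_le_of_norm_le_const (μ := θ)
      (.of_forall fun v => ih (f x + tproj n v))

theorem integral_noiseAverage_iterate {μ : Measure (Torus n)} (hf : Continuous f)
    (hstat : IsStationaryT (fun v x => f x + tproj n v) θ μ) (hψ : Continuous ψ) (M : ℕ) :
    ∫ x, (noiseAverage f θ)^[M] ψ x ∂μ = ∫ x, ψ x ∂μ := by
  induction M with
  | zero => rfl
  | succ M ih =>
    rw [Function.iterate_succ_apply', ← ih]
    exact hstat ⟨_, continuous_noiseAverage_iterate hf hψ M⟩

/-- The averaged iterates are dual to the random compositions of transfer operators. -/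
theorem setIntegral_noiseAverage_iterate_mul_le {F G : (Fin n → ℝ) → Fin n → ℝ}
    {w : (Fin n → ℝ) → ℝ} {A : (Fin n → ℤ) →+ (Fin n → ℤ)} {R : Finset (Fin n → ℤ)}
    (h : BranchSystem F G w A R) (hlift : ∀ x, f (tproj n x) = tproj n (F x))
    (hf : Continuous f) (hψ : Continuous ψ) (hψ0 : ∀ x, 0 ≤ ψ x) {g : (Fin n → ℝ) → ℝ}
    (hg : Continuous g) (hgp : LatticePeriodic g) {ε B : ℝ} (hθ : ∀ᵐ v ∂θ, ‖v‖ ≤ ε) {i j : ℕ}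
    (hB : ∀ v : ℕ → Fin n → ℝ, (∀ i, ‖v i‖ ≤ ε) → ∀ y,
      transferIterate G w R v (fun _ => 1) g (i + j) y ≤ B)
    {v : ℕ → Fin n → ℝ} (hv : ∀ i, ‖v i‖ ≤ ε) :
    ∫ x in unitCube 0, (noiseAverage f θ)^[j] ψ (tproj n x) *
      transferIterate G w R v (fun _ => 1) g i x ≤ B * ∫ p, ψ p := by
  have hT := continuous_tproj n
  induction j generalizing i v with
  | zero =>
    rw [← setIntegral_unitCube_comp_tproj hψ, ← integral_const_mul]
    have hc := h.continuous_transferIterate v hg i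
    simp only [Function.iterate_zero, id]
    refine integral_mono (Continuous.integrableOn_unitCube (by fun_prop) 0)
      (Continuous.integrableOn_unitCube (by fun_prop) 0) fun x => ?_
    dsimp only
    rw [mul_comm]
    exact mul_le_mul_of_nonneg_right (hB v hv x) (hψ0 _)
  | succ j ih =>
    have hc := h.continuous_transferIterate v hg i
    have hU : Continuous ((noiseAverage f θ)^[j] ψ) := continuous_noiseAverage_iterate hf hψ j
    set T := transferIterate G w R v (fun _ => 1) g i with hTdef
    set Ψ := (noiseAverage f θ)^[j] ψ
    have hF := h.differentiable_F.continuous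
    have hI : Integrable (Function.uncurry fun x u => Ψ (tproj n (F x + u)) * T x)
        ((volume.restrict (unitCube 0)).prod θ) := by
      obtain ⟨b, hb⟩ := isCompact_univ.exists_bound_of_continuousOn hU.continuousOn
      have hi : Integrable (fun z : (Fin n → ℝ) × (Fin n → ℝ) => T z.1)
          ((volume.restrict (unitCube 0)).prod θ) := by
        simpa using (hc.integrableOn_unitCube 0).mul_prod (integrable_const (1 : ℝ))
      refine hi.bdd_mul (c := b) ?_ (.of_forall fun z => hb (tproj n (F z.1 + z.2)) (mem_univ _))
      exact Continuous.aestronglyMeasurable (by fun_prop)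
    have hswap : ∫ x in unitCube 0, (noiseAverage f θ)^[j + 1] ψ (tproj n x) * T x =
        ∫ u, (∫ x in unitCube 0, Ψ (tproj n (F x + u)) * T x) ∂θ := by
      rw [← integral_integral_swap hI]
      refine integral_congr_ae (.of_forall fun x => ?_)
      simp only [Function.iterate_succ_apply', noiseAverage, hlift, tproj_add]
      rw [← integral_mul_const]
    rw [hswap]
    have hbd : ∀ᵐ u ∂θ, ∫ x in unitCube 0, Ψ (tproj n (F x + u)) * T x ≤ B * ∫ p, ψ p := by
      filter_upwards [hθ] with u hu
      rw [h.setIntegral_comp_mul u (ψ := fun y => Ψ (tproj n y)) hc (by fun_prop)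
        (h.latticePeriodic_transferIterate v hgp i) (fun x l => by simp only [tproj_add_intVec])]
      have hv' : ∀ m, ‖Function.update v i u m‖ ≤ ε := fun m => by
        rcases eq_or_ne m i with rfl | hm
        · simpa using hu
        · simpa [hm] using hv m
      have h1 := ih (i := i + 1) (by rwa [add_assoc, add_comm 1 j]) hv'
      convert h1 using 5
      rw [transferIterate, BranchSystem.transferIterate_congr (v' := v) fun m hm => by simp [hm.ne]]
      simp [hTdef]
    simpa using integral_mono_ae hI.integral_prod_right (integrable_const _) hbd

end NoiseAverage

theorem measure_compl_mSupport {Y : Type*} [TopologicalSpace Y] [SecondCountableTopology Y]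
    [MeasurableSpace Y] (θ : Measure Y) : θ (mSupport θ)ᶜ = 0 := by
  refine measure_null_of_locally_null _ fun x hx => ?_
  simp only [mSupport, mem_compl_iff, mem_ofPred_eq, not_forall, not_not] at hx
  obtain ⟨U, hU, hU0⟩ := hx
  exact ⟨U, mem_nhdsWithin_of_mem_nhds hU, hU0⟩

section Stationary

variable {n : ℕ} {f : Torus n → Torus n} {θ : Measure (Fin n → ℝ)} [IsProbabilityMeasure θ]
  {μ : Measure (Torus n)} [IsProbabilityMeasure μ]

theorem IsStationaryT.absolutelyContinuous (hf : Continuous f) (hθ : θ ≪ volume)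
    (hstat : IsStationaryT (fun v x => f x + tproj n v) θ μ) : μ ≪ volume := by
  have hT := continuous_tproj n
  have hc : Continuous fun z : Torus n × (Fin n → ℝ) => f z.1 + tproj n z.2 := by fun_prop
  have hμ : Measure.map (fun z : Torus n × (Fin n → ℝ) => f z.1 + tproj n z.2) (μ.prod θ) = μ := by
    have := Measure.isProbabilityMeasure_map (μ := μ.prod θ) hc.aemeasurable
    refine ext_of_forall_integral_eq_of_IsFiniteMeasure fun φ => ?_
    rw [integral_map hc.aemeasurable φ.continuous.aestronglyMeasurable, integral_prod]
    · exact hstat φ.toContinuousMap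
    · exact (φ.compContinuous ⟨_, hc⟩).integrable (μ.prod θ)
  refine Measure.AbsolutelyContinuous.mk fun s hs hs0 => ?_
  rw [← hμ, Measure.map_apply hc.measurable hs,
    Measure.measure_prod_null (hc.measurable hs)]
  refine .of_forall fun x => hθ ?_
  have := (quasiMeasurePreserving_tproj n).preimage_null (s := (fun y => f x + y) ⁻¹' s)
    (by rw [measure_preimage_add, hs0])
  exact this

theorem IsStationaryT.integral_le {F G : (Fin n → ℝ) → Fin n → ℝ} {w : (Fin n → ℝ) → ℝ}
    {A : (Fin n → ℤ) →+ (Fin n → ℤ)} {R : Finset (Fin n → ℤ)} (h : BranchSystem F G w A R)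
    (hlift : ∀ x, f (tproj n x) = tproj n (F x)) (hf : Continuous f) (hθ : θ ≪ volume)
    (hstat : IsStationaryT (fun v x => f x + tproj n v) θ μ) {α ε C : ℝ} (hα0 : 0 < α)
    (hα1 : α ≤ 1) (hε : 0 ≤ ε) (hC : 0 ≤ C) (N₀ : ℕ)
    (hbound : ∀ (φ : (Fin n → ℝ) → ℝ) (H : ℝ), Continuous φ → LatticePeriodic φ →
      (∀ x, 0 ≤ φ x) → 0 ≤ H → (∀ x x', |φ x - φ x'| ≤ H * ‖x - x'‖ ^ α) →
      ∀ v : ℕ → Fin n → ℝ, (∀ i, ‖v i‖ ≤ ε) → ∀ (j : ℕ) y,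
        transferIterate G w R v (fun _ => 1) φ (j * N₀) y
          ≤ C * (∫ x in unitCube 0, φ x) + H / 2 ^ j)
    (hθε : ∀ᵐ v ∂θ, ‖v‖ ≤ ε) {ψ : Torus n → ℝ} (hψ : Continuous ψ) (hψ0 : ∀ x, 0 ≤ ψ x) :
    ∫ x, ψ x ∂μ ≤ C * ∫ x, ψ x := by
  have hvol := isProbabilityMeasure_volume_torus n
  have hT := continuous_tproj n
  obtain ⟨b, hb⟩ := isCompact_univ.exists_bound_of_continuousOn hψ.continuousOn
  replace hb : ∀ x, ‖ψ x‖ ≤ b := fun x => hb x (mem_univ x)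
  have hb0 : 0 ≤ b := (norm_nonneg _).trans (hb 0)
  have hI0 : 0 ≤ ∫ x, ψ x := integral_nonneg hψ0
  have hac := hstat.absolutelyContinuous hf hθ
  set r : Torus n → ℝ := fun x => (μ.rnDeriv volume x).toReal
  have hr : Integrable r := Measure.integrable_toReal_rnDeriv
  have hr1 : ∫ x, r x = 1 := by
    rw [Measure.integral_toReal_rnDeriv hac]; simp
  have key : ∀ δ > 0, ∫ x, ψ x ∂μ ≤ C * (1 + 2 * δ) * (∫ x, ψ x) + b * (2 * δ) := by
    intro δ hδ
    obtain ⟨g₀, hg₀, -⟩ := hr.exists_boundedContinuous_integral_sub_le hδ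
    obtain ⟨g, L, hL, hg0, hgL, hgg⟩ := exists_lipschitz_approx (g := fun x => max (g₀ x) 0)
      (by fun_prop) (fun x => le_max_right _ _) hδ
    have hgc : Continuous g := by
      refine (LipschitzWith.of_dist_le_mul (K := L.toNNReal) fun x y => ?_).continuous
      rw [Real.coe_toNNReal _ hL]
      exact hgL x y
    have hgi : Integrable g :=
      hgc.integrable_of_hasCompactSupport (HasCompactSupport.of_compactSpace g)
    have hg₀i : Integrable g₀ := g₀.integrable volume
    have hrgi : Integrable fun x => |r x - g x| := (hr.sub hgi).abs
    have hrg₀i : Integrable fun x => ‖r x - g₀ x‖ := (hr.sub hg₀i).norm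
    have hrg : ∫ x, |r x - g x| ≤ 2 * δ := by
      have h1 : ∫ x, |r x - g x| ≤ ∫ x, (‖r x - g₀ x‖ + δ) := by
        refine integral_mono hrgi (hrg₀i.add (integrable_const δ))
          fun x => ?_
        have h2 : |r x - max (g₀ x) 0| ≤ |r x - g₀ x| := by
          have h3 : max (r x) 0 = r x := max_eq_left ENNReal.toReal_nonneg
          conv_lhs => rw [← h3]
          exact abs_max_sub_max_le_abs _ _ _
        have h4 := abs_sub_le (r x) (max (g₀ x) 0) (g x)
        have h5 := hgg x
        simp only [Real.norm_eq_abs]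
        linarith
      rw [integral_add hrg₀i (integrable_const δ)] at h1
      simp only [integral_const, probReal_univ, one_smul] at h1
      linarith
    have hgint : ∫ x, g x ≤ 1 + 2 * δ := by
      have h1 := integral_mono (f := g) (g := fun x => r x + |r x - g x|) hgi
        (hr.add hrgi) fun x => by
          have := neg_abs_le (r x - g x)
          simp only
          linarith
      rw [integral_add hr hrgi, hr1] at h1
      linarith
    have hper : LatticePeriodic fun x => g (tproj n x) := fun x l => by
      simp only [tproj_add_intVec]
    have hHol : ∀ x x', |g (tproj n x) - g (tproj n x')| ≤ L * ‖x - x'‖ ^ α := fun x x' => by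
      refine (hgL _ _).trans (mul_le_mul_of_nonneg_left ?_ hL)
      rw [dist_eq_norm, ← tproj_sub]
      have h1 : ‖tproj n (x - x')‖ ≤ 1 := (pi_norm_le_iff_of_nonneg one_pos.le).2 fun i =>
        (AddCircle.norm_le_half_period 1 one_ne_zero).trans (by norm_num)
      calc ‖tproj n (x - x')‖ ≤ ‖tproj n (x - x')‖ ^ α :=
            Real.self_le_rpow_of_le_one (norm_nonneg _) h1 hα1
        _ ≤ ‖x - x'‖ ^ α := Real.rpow_le_rpow (norm_nonneg _) (norm_tproj_le _) hα0.le
    have hj : ∀ j : ℕ, ∫ x, ψ x ∂μ ≤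
        (C * (1 + 2 * δ) + L / 2 ^ j) * (∫ x, ψ x) + b * (2 * δ) := by
      intro j
      set Ψ := (noiseAverage f θ)^[j * N₀] ψ
      have hΨc : Continuous Ψ := continuous_noiseAverage_iterate hf hψ _
      have hΨb : ∀ x, ‖Ψ x‖ ≤ b := norm_noiseAverage_iterate_le hb _
      have h1 : ∫ x, Ψ x * g x ≤ (C * (∫ x, g x) + L / 2 ^ j) * ∫ x, ψ x := by
        rw [← setIntegral_unitCube_comp_tproj (by fun_prop : Continuous fun x => Ψ x * g x)]
        have := setIntegral_noiseAverage_iterate_mul_le h hlift hf hψ hψ0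
          (g := fun x => g (tproj n x)) (by fun_prop) hper hθε (i := 0) (j := j * N₀)
          (B := C * (∫ x, g x) + L / 2 ^ j) (fun v hv y => by
            rw [zero_add, ← setIntegral_unitCube_comp_tproj hgc]
            exact hbound _ L (by fun_prop) hper (fun x => hg0 _) hL hHol v hv j y)
          (v := fun _ => 0) (fun _ => by simpa using hε)
        exact this
      have h2 : ∫ x, ψ x ∂μ = ∫ x, r x * Ψ x := by
        rw [← integral_noiseAverage_iterate hf hstat hψ (j * N₀)]
        simpa using (integral_rnDeriv_smul (f := Ψ) hac).symm
      have hi1 : Integrable fun x => r x * Ψ x :=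
        hr.mul_bdd (c := b) hΨc.aestronglyMeasurable (.of_forall hΨb)
      have hi2 : Integrable fun x => Ψ x * g x :=
        hgi.bdd_mul (c := b) hΨc.aestronglyMeasurable (.of_forall hΨb)
      have h3 : ∫ x, r x * Ψ x ≤ ∫ x, (Ψ x * g x + b * |r x - g x|) := by
        refine integral_mono hi1 (hi2.add (hrgi.const_mul b)) fun x => ?_
        have h4 := hΨb x
        rw [Real.norm_eq_abs] at h4
        have h5 := mul_le_mul_of_nonneg_right h4 (abs_nonneg (r x - g x))
        rw [← abs_mul] at h5
        have h6 := le_abs_self (Ψ x * (r x - g x))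
        simp only
        linarith
      rw [integral_add hi2 (hrgi.const_mul b), integral_const_mul] at h3
      have h7 := mul_le_mul_of_nonneg_left hrg hb0
      have h8 := mul_le_mul_of_nonneg_right (mul_le_mul_of_nonneg_left hgint hC) hI0
      rw [h2]
      linarith
    have hlim : Tendsto (fun j : ℕ => (C * (1 + 2 * δ) + L / 2 ^ j) * (∫ x, ψ x) + b * (2 * δ))
        atTop (𝓝 ((C * (1 + 2 * δ) + 0) * (∫ x, ψ x) + b * (2 * δ))) := by
      refine (((tendsto_const_nhds.add ?_).mul_const _).add_const _)
      have := (tendsto_pow_atTop_nhds_zero_of_lt_one (r := (1 / 2 : ℝ)) (by norm_num)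
        (by norm_num)).const_mul L
      simpa [div_eq_mul_inv] using this
    rw [add_zero] at hlim
    exact ge_of_tendsto' hlim hj
  have hlim : Tendsto (fun δ : ℝ => C * (1 + 2 * δ) * (∫ x, ψ x) + b * (2 * δ)) (𝓝[>] 0)
      (𝓝 (C * (1 + 2 * 0) * (∫ x, ψ x) + b * (2 * 0))) :=
    (Continuous.tendsto (by fun_prop) 0).mono_left nhdsWithin_le_nhds
  have := ge_of_tendsto hlim (eventually_mem_nhdsWithin.mono fun δ hδ => key δ hδ)
  simpa using this

end Stationary

theorem absolutelyContinuous_of_integral_le {X : Type*} [PseudoMetricSpace X] [CompactSpace X]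
    [MeasurableSpace X] [BorelSpace X] {μ ν : Measure X} [IsFiniteMeasure μ]
    [IsFiniteMeasure ν] {C : ℝ} (hC : 0 ≤ C)
    (h : ∀ ψ : C(X, ℝ), (∀ x, 0 ≤ ψ x) → ∫ x, ψ x ∂μ ≤ C * ∫ x, ψ x ∂ν) : μ ≪ ν := by
  refine Measure.AbsolutelyContinuous.mk fun s hs hs0 => ?_
  rw [hs.measure_eq_iSup_isClosed_of_ne_top (measure_ne_top μ s)]
  simp only [ENNReal.iSup_eq_zero]
  intro K hKs hK
  have key : ∀ δ > 0, μ.real K ≤ C * δ := by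
    intro δ hδ
    obtain ⟨U, hsU, hU, hνU⟩ := s.exists_isOpen_lt_of_lt (μ := ν) (ENNReal.ofReal δ)
      (by rw [hs0]; simpa using hδ)
    obtain ⟨ψ, hψ0, hψ1, hψ⟩ := exists_continuous_zero_one_of_isClosed hU.isClosed_compl hK
      (disjoint_compl_left_iff_subset.2 (hKs.trans hsU))
    have hi : ∀ (m : Measure X) [IsFiniteMeasure m], Integrable ψ m := fun m _ =>
      ψ.continuous.integrable_of_hasCompactSupport (HasCompactSupport.of_compactSpace _)
    have h1 : μ.real K ≤ ∫ x, ψ x ∂μ := by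
      rw [← integral_indicator_one hK.measurableSet]
      refine integral_mono ((integrable_const (1 : ℝ)).indicator hK.measurableSet) (hi μ)
        fun x => ?_
      exact indicator_le' (fun x hx => (hψ1 hx).ge) (fun x _ => (hψ x).1) x
    have h2 : ∫ x, ψ x ∂ν ≤ ν.real U := by
      rw [← integral_indicator_one hU.measurableSet]
      refine integral_mono (hi ν) ((integrable_const (1 : ℝ)).indicator hU.measurableSet)
        fun x => ?_
      by_cases hx : x ∈ U
      · simpa [hx] using (hψ x).2
      · simpa [hx] using (hψ0 hx).le
    have h3 : ν.real U ≤ δ := ENNReal.toReal_le_of_le_ofReal hδ.le hνU.le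
    exact (h1.trans (h ψ fun x => (hψ x).1)).trans (by gcongr; exact h2.trans h3)
  have hlim : Tendsto (fun δ : ℝ => C * δ) (𝓝[>] 0) (𝓝 (C * 0)) :=
    (Continuous.tendsto (by fun_prop) 0).mono_left nhdsWithin_le_nhds
  have h0 := ge_of_tendsto hlim (eventually_mem_nhdsWithin.mono fun δ hδ => key δ hδ)
  rw [mul_zero] at h0
  exact (measureReal_eq_zero_iff).1 (h0.antisymm measureReal_nonneg)

theorem exists_noiseAverage_sub_le {n : ℕ} {φ : C(Torus n, ℝ)} {δ : ℝ} (hδ : 0 < δ) :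
    ∃ η > 0, ∀ (f : Torus n → Torus n) (θ : Measure (Fin n → ℝ)) [IsProbabilityMeasure θ],
      (∀ᵐ v ∂θ, ‖v‖ ≤ η) → ∀ x, |noiseAverage f θ φ x - φ (f x)| ≤ δ := by
  obtain ⟨η, hη, h⟩ := Metric.uniformContinuous_iff.1
    (CompactSpace.uniformContinuous_of_continuous φ.continuous) δ hδ
  refine ⟨η / 2, half_pos hη, fun f θ _ hθ x => ?_⟩
  have hT := continuous_tproj n
  have hi : Integrable (fun v => φ (f x + tproj n v)) θ := by
    obtain ⟨b, hb⟩ := isCompact_univ.exists_bound_of_continuousOn φ.continuous.continuousOn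
    exact Integrable.of_bound (Continuous.aestronglyMeasurable (by fun_prop)) b
      (.of_forall fun v => hb _ (mem_univ _))
  have h1 : noiseAverage f θ φ x - φ (f x) = ∫ v, (φ (f x + tproj n v) - φ (f x)) ∂θ := by
    rw [integral_sub hi (integrable_const _)]
    simp [noiseAverage]
  rw [h1]
  have h2 := norm_integral_le_of_norm_le_const (μ := θ) (C := δ)
    (f := fun v => φ (f x + tproj n v) - φ (f x)) (hθ.mono fun v hv => by
      have := h (a := f x + tproj n v) (b := f x) (by
        rw [dist_eq_norm, add_sub_cancel_left]
        linarith [norm_tproj_le v])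
      rw [dist_eq_norm] at this
      exact this.le)
  simpa using h2

/-- stochastic stability. If `|det Df| > 1` on `K` and `μ0` is the unique
absolutely continuous `f`-invariant probability measure, then the stationary measures
of the additive random perturbations converge to `μ0` in the weak* topology. -/
theorem stochastically_stable
    (n : ℕ) (α : ℝ) (f : Torus n → Torus n) (F : (Fin n → ℝ) → Fin n → ℝ)
    (hyp : TorusHyp n α f F)
    (hdet : ∀ x ∈ KsetF n F, 1 < |(fderiv ℝ F x).det|)
    (μ0 : Measure (Torus n)) (hμ0prob : IsProbabilityMeasure μ0)
    (hμ0inv : Measure.map f μ0 = μ0) (hμ0ac : μ0 ≪ volume)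
    (hμ0uniq : ∀ ν : Measure (Torus n), IsProbabilityMeasure ν → Measure.map f ν = ν →
      ν ≪ volume → ν = μ0)
    (ε : ℕ → ℝ) (hεpos : ∀ k, 0 < ε k) (hεlim : Tendsto ε atTop (𝓝 0))
    (θ : ℕ → Measure (Fin n → ℝ)) (hθprob : ∀ k, IsProbabilityMeasure (θ k))
    (hθac : ∀ k, θ k ≪ volume)
    (hθsupp : ∀ k, mSupport (θ k) ⊆ Metric.closedBall (0 : Fin n → ℝ) (ε k))
    (hθint : ∀ k, (interior (mSupport (θ k))).Nonempty)
    (μ : ℕ → Measure (Torus n)) (hμprob : ∀ k, IsProbabilityMeasure (μ k))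
    (hstat : ∀ k, IsStationaryT (fun v x => f x + tproj n v) (θ k) (μ k)) :
    ∀ φ : C(Torus n, ℝ),
      Tendsto (fun k => ∫ x, φ x ∂(μ k)) atTop (𝓝 (∫ x, φ x ∂μ0)) := by
  have hf := hyp.continuous
  obtain ⟨G, w, A, R, h, ε₁, hε₁, C, hC, N₀, hbound⟩ := hyp.exists_branchSystem hdet
  have hθε : ∀ k, ∀ᵐ v ∂θ k, ‖v‖ ≤ ε k := fun k => by
    filter_upwards [measure_eq_zero_iff_ae_notMem.1 (measure_compl_mSupport (θ k))] with v hv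
    simpa using hθsupp k (not_not.1 hv)
  let P : ℕ → ProbabilityMeasure (Torus n) := fun k => ⟨μ k, hμprob k⟩
  intro φ
  rw [tendsto_iff_ultrafilter]
  intro u hu
  obtain ⟨ν, -, hν⟩ := isCompact_univ.ultrafilter_le_nhds (u.map P) (by simp)
  have hlim : ∀ ψ : C(Torus n, ℝ), Tendsto (fun k => ∫ x, ψ x ∂μ k) u
      (𝓝 (∫ x, ψ x ∂(ν : Measure (Torus n)))) := fun ψ =>
    ProbabilityMeasure.tendsto_iff_forall_integral_tendsto.1 hν
      (BoundedContinuousFunction.mkOfCompact ψ)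
  have hεu : Tendsto ε u (𝓝 0) := hεlim.mono_left hu
  have hac : (ν : Measure (Torus n)) ≪ volume := by
    refine absolutelyContinuous_of_integral_le hC.le fun ψ hψ => ?_
    refine le_of_tendsto (hlim ψ) ?_
    filter_upwards [hεu.eventually_le_const hε₁] with k hk
    exact (hstat k).integral_le h hyp.hlift hf (hθac k) hyp.hα0 hyp.hα1 hε₁.le hC.le N₀ hbound
      ((hθε k).mono fun v hv => hv.trans hk) ψ.continuous hψ
  have hinv : Measure.map f (ν : Measure (Torus n)) = ν := by
    have := Measure.isProbabilityMeasure_map (μ := (ν : Measure (Torus n))) hf.aemeasurable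
    refine ext_of_forall_integral_eq_of_IsFiniteMeasure fun ψ => ?_
    rw [integral_map hf.aemeasurable ψ.continuous.aestronglyMeasurable]
    refine tendsto_nhds_unique (hlim (ψ.toContinuousMap.comp ⟨f, hf⟩)) ?_
    have hdiff : Tendsto (fun k => ∫ x, ψ x ∂μ k - ∫ x, ψ (f x) ∂μ k) u (𝓝 0) := by
      rw [Metric.tendsto_nhds]
      intro δ hδ
      obtain ⟨η, hη, hηδ⟩ := exists_noiseAverage_sub_le (φ := ψ.toContinuousMap) (half_pos hδ)
      filter_upwards [hεu.eventually_le_const hη] with k hk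
      rw [dist_zero_right, ← integral_noiseAverage_iterate hf (hstat k) ψ.continuous 1,
        ← integral_sub]
      · refine lt_of_le_of_lt ?_ (half_lt_self hδ)
        simpa using norm_integral_le_of_norm_le_const (μ := μ k) (C := δ / 2)
          (f := fun x => noiseAverage f (θ k) ψ x - ψ (f x))
          (.of_forall (hηδ f (θ k) ((hθε k).mono fun v hv => hv.trans hk)))
      · exact (BoundedContinuousFunction.mkOfCompact
          ⟨_, continuous_noiseAverage (θ := θ k) hf ψ.continuous⟩).integrable (μ k)
      · exact (ψ.compContinuous ⟨f, hf⟩).integrable (μ k)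
    simpa using (hlim ψ.toContinuousMap).sub hdiff
  rw [← hμ0uniq ν inferInstance hinv hac]
  exact hlim φ
end
end

section
/- For every nonempty open subset U ⊆ 𝕋^n there exists an integer N ≥ 1 such that f^N(U) = 𝕋^n, where f^N denotes the N-th iterate of f. -/
open MeasureTheory Set Filter Topology

noncomputable section

section Expansion

variable {E : Type*} [NormedAddCommGroup E] [NormedSpace ℝ E]

/-- Near `F x` a local diffeomorphism has a continuous right inverse which is Lipschitz at `F x`
with any constant bounding the inverse derivative near `x`. -/
theorem exists_local_right_inverse [CompleteSpace E] {F : E → E} (hF : ContDiff ℝ 1 F)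
    (hunit : ∀ x, IsUnit (fderiv ℝ F x)) (x : E) (c : ℝ)
    (hc : ∀ᶠ z in 𝓝 x, ‖Ring.inverse (fderiv ℝ F z)‖ ≤ c) :
    ∃ g : E → E, g (F x) = x ∧ ContinuousAt g (F x) ∧
      ∀ᶠ y in 𝓝 (F x), F (g y) = y ∧ ‖g y - x‖ ≤ c * ‖y - F x‖ := by
  obtain ⟨u, hu⟩ := hunit x
  have hs : HasStrictFDerivAt F
      ((ContinuousLinearEquiv.unitsEquiv ℝ E u : E ≃L[ℝ] E) : E →L[ℝ] E) x := by
    have h := (hF.contDiffAt (x := x)).hasStrictFDerivAt one_ne_zero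
    rw [← hu] at h
    exact h
  set e := hs.toOpenPartialHomeomorph F with he
  have hxs : x ∈ e.source := hs.mem_toOpenPartialHomeomorph_source
  have hxt : F x ∈ e.target := hs.image_mem_toOpenPartialHomeomorph_target
  have hgx : e.symm (F x) = x := e.left_inv hxs
  have hcont : ContinuousAt e.symm (F x) := e.continuousAt_symm hxt
  refine ⟨e.symm, hgx, hcont, ?_⟩
  have hev : ∀ᶠ y in 𝓝 (F x), y ∈ e.target ∧ ‖Ring.inverse (fderiv ℝ F (e.symm y))‖ ≤ c := by
    refine Filter.Eventually.and (e.open_target.mem_nhds hxt) ?_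
    have h2 : Tendsto e.symm (𝓝 (F x)) (𝓝 x) := by
      have := hcont.tendsto
      rwa [hgx] at this
    exact h2.eventually hc
  obtain ⟨ρ, hρ, hball⟩ := Metric.eventually_nhds_iff_ball.1 hev
  filter_upwards [Metric.ball_mem_nhds (F x) hρ] with y hy
  have hr : ∀ z ∈ e.target, F (e.symm z) = z := fun z hz => e.right_inv hz
  refine ⟨hr y (hball y hy).1, ?_⟩
  have key : ∀ z ∈ Metric.ball (F x) ρ,
      HasFDerivWithinAt e.symm (Ring.inverse (fderiv ℝ F (e.symm z))) (Metric.ball (F x) ρ) z := by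
    intro z hz
    have hzt := (hball z hz).1
    obtain ⟨v, hv⟩ := hunit (e.symm z)
    have hd : HasFDerivAt F
        ((ContinuousLinearEquiv.unitsEquiv ℝ E v : E ≃L[ℝ] E) : E →L[ℝ] E) (e.symm z) := by
      have h := (hF.differentiable one_ne_zero (e.symm z)).hasFDerivAt
      rw [← hv] at h
      exact h
    have hinv := HasFDerivAt.of_local_left_inverse (e.continuousAt_symm hzt) hd
      (by filter_upwards [e.open_target.mem_nhds hzt] with w hw using hr w hw)
    rw [← hv, Ring.inverse_unit]
    exact hinv.hasFDerivWithinAt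
  have := (convex_ball (F x) ρ).norm_image_sub_le_of_norm_hasFDerivWithin_le key
    (fun z hz => (hball z hz).2) (Metric.mem_ball_self hρ) hy
  rwa [hgx] at this

/-- A local diffeomorphism whose inverse derivative has norm at most one maps closed balls onto
sets containing the closed ball of the same radius. -/
theorem exists_preimage_norm_sub_le [ProperSpace E] {F : E → E} (hF : ContDiff ℝ 1 F)
    (hunit : ∀ x, IsUnit (fderiv ℝ F x)) (hinv : ∀ x, ‖Ring.inverse (fderiv ℝ F x)‖ ≤ 1)
    (x y : E) : ∃ z, F z = y ∧ ‖z - x‖ ≤ ‖y - F x‖ := by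
  have : CompleteSpace E := complete_of_proper
  set v := y - F x with hv
  set S : Set ℝ := {t | ∃ z, F z = F x + t • v ∧ ‖z - x‖ ≤ t * ‖v‖} with hS
  have hclosed : IsClosed (S ∩ Icc 0 1) := by
    have hK : IsCompact ((Icc (0 : ℝ) 1 ×ˢ Metric.closedBall x ‖v‖) ∩
        {p : ℝ × E | F p.2 = F x + p.1 • v ∧ ‖p.2 - x‖ ≤ p.1 * ‖v‖}) := by
      refine (isCompact_Icc.prod (isCompact_closedBall _ _)).inter_right ?_
      have hFc := hF.continuous
      have h1 : IsClosed {p : ℝ × E | F p.2 = F x + p.1 • v} :=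
        isClosed_eq (by fun_prop) (by fun_prop)
      have h2 : IsClosed {p : ℝ × E | ‖p.2 - x‖ ≤ p.1 * ‖v‖} :=
        isClosed_le (by fun_prop) (by fun_prop)
      exact h1.inter h2
    have himg := (hK.image continuous_fst).isClosed
    convert himg using 1
    ext t
    constructor
    · rintro ⟨⟨z, hz1, hz2⟩, ht⟩
      refine ⟨(t, z), ⟨⟨ht, ?_⟩, hz1, hz2⟩, rfl⟩
      rw [mem_closedBall_iff_norm]
      exact hz2.trans (mul_le_of_le_one_left (norm_nonneg _) ht.2)
    · rintro ⟨⟨s, z⟩, ⟨⟨hs, -⟩, hz1, hz2⟩, rfl⟩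
      exact ⟨⟨z, hz1, hz2⟩, hs⟩
  have hsub : Icc (0 : ℝ) 1 ⊆ S := by
    refine hclosed.Icc_subset_of_forall_exists_gt ⟨x, by simp, by simp⟩ ?_
    rintro t ⟨⟨z, hz1, hz2⟩, -⟩ s hs
    obtain ⟨g, -, -, hg⟩ := exists_local_right_inverse hF hunit z 1 (Eventually.of_forall hinv)
    have hγ : Tendsto (fun r : ℝ => F x + r • v) (𝓝[>] t) (𝓝 (F z)) := by
      rw [hz1]
      exact ((by fun_prop : Continuous fun r : ℝ => F x + r • v).tendsto t).mono_left
        nhdsWithin_le_nhds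
    obtain ⟨r, ⟨hr1, hr2⟩, hr⟩ :=
      ((hγ.eventually hg).and (Ioc_mem_nhdsGT hs)).exists
    refine ⟨r, ⟨g (F x + r • v), hr1, ?_⟩, hr⟩
    have h1 : F x + r • v - F z = (r - t) • v := by rw [hz1]; module
    rw [h1, norm_smul, Real.norm_of_nonneg (sub_nonneg.2 hr.1.le)] at hr2
    calc ‖g (F x + r • v) - x‖ ≤ ‖g (F x + r • v) - z‖ + ‖z - x‖ :=
          norm_sub_le_norm_sub_add_norm_sub _ _ _
      _ ≤ r * ‖v‖ := by linarith
  obtain ⟨z, hz1, hz2⟩ := hsub (right_mem_Icc.2 zero_le_one)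
  exact ⟨z, by rw [hz1, hv]; module, by simpa using hz2⟩

/-- Strict form of `exists_preimage_norm_sub_le` at a point where the inverse derivative has norm
less than one. -/
theorem exists_preimage_norm_sub_lt_of_lt [ProperSpace E] {F : E → E} (hF : ContDiff ℝ 1 F)
    (hunit : ∀ x, IsUnit (fderiv ℝ F x)) (hinv : ∀ x, ‖Ring.inverse (fderiv ℝ F x)‖ ≤ 1)
    {x y : E} (hx : ‖Ring.inverse (fderiv ℝ F x)‖ < 1) (hxy : y ≠ F x) :
    ∃ z, F z = y ∧ ‖z - x‖ < ‖y - F x‖ := by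
  have : CompleteSpace E := complete_of_proper
  obtain ⟨c, hc1, hc2⟩ := exists_between hx
  have hcont : ContinuousAt (fun z => ‖Ring.inverse (fderiv ℝ F z)‖) x := by
    obtain ⟨u, hu⟩ := hunit x
    have h1 : ContinuousAt Ring.inverse (fderiv ℝ F x) := by
      rw [← hu]; exact NormedRing.inverse_continuousAt u
    exact (h1.comp (f := fderiv ℝ F) (hF.continuous_fderiv one_ne_zero).continuousAt).norm
  obtain ⟨g, -, -, hg⟩ := exists_local_right_inverse hF hunit x c
    ((hcont.eventually_lt_const hc1).mono fun _ h => h.le)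
  set v := y - F x with hv
  have hv0 : 0 < ‖v‖ := norm_pos_iff.2 (sub_ne_zero.2 hxy)
  have hγ : Tendsto (fun r : ℝ => F x + r • v) (𝓝[>] 0) (𝓝 (F x)) := by
    have := ((by fun_prop : Continuous fun r : ℝ => F x + r • v).tendsto 0).mono_left
      (nhdsWithin_le_nhds (s := Ioi 0))
    simpa using this
  obtain ⟨r, ⟨hr1, hr2⟩, hr⟩ :=
    ((hγ.eventually hg).and (Ioc_mem_nhdsGT (zero_lt_one (α := ℝ)))).exists
  obtain ⟨z, hz1, hz2⟩ := exists_preimage_norm_sub_le hF hunit hinv (g (F x + r • v)) y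
  refine ⟨z, hz1, ?_⟩
  have h1 : y - F (g (F x + r • v)) = (1 - r) • v := by rw [hr1, hv]; module
  rw [h1, norm_smul, Real.norm_of_nonneg (sub_nonneg.2 hr.2)] at hz2
  rw [add_sub_cancel_left, norm_smul, Real.norm_of_nonneg hr.1.le] at hr2
  have h2 := norm_sub_le_norm_sub_add_norm_sub z (g (F x + r • v)) x
  have h3 : c * (r * ‖v‖) < r * ‖v‖ := mul_lt_of_lt_one_left (mul_pos hr.1 hv0) hc2
  linarith

/-- Strict form of `exists_preimage_norm_sub_le` when the points at which the inverse derivative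
has norm one are isolated. -/
theorem exists_preimage_norm_sub_lt [ProperSpace E] {F : E → E} (hF : ContDiff ℝ 1 F)
    (hunit : ∀ x, IsUnit (fderiv ℝ F x)) (hinv : ∀ x, ‖Ring.inverse (fderiv ℝ F x)‖ ≤ 1)
    (hiso : ∀ x, ∀ᶠ z in 𝓝[≠] x, ‖Ring.inverse (fderiv ℝ F z)‖ < 1)
    {x y : E} (hxy : y ≠ F x) :
    ∃ z, F z = y ∧ ‖z - x‖ < ‖y - F x‖ := by
  have : CompleteSpace E := complete_of_proper
  obtain ⟨g, hgx, hgc, hg⟩ :=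
    exists_local_right_inverse hF hunit x 1 (Eventually.of_forall hinv)
  set v := y - F x with hv
  have hv0 : v ≠ 0 := sub_ne_zero.2 hxy
  have hγ : Tendsto (fun r : ℝ => F x + r • v) (𝓝[>] 0) (𝓝 (F x)) := by
    have := ((by fun_prop : Continuous fun r : ℝ => F x + r • v).tendsto 0).mono_left
      (nhdsWithin_le_nhds (s := Ioi 0))
    simpa using this
  have hgt : Tendsto g (𝓝 (F x)) (𝓝 x) := by
    have := hgc.tendsto
    rwa [hgx] at this
  have hK := (hgt.comp hγ).eventually (eventually_nhdsWithin_iff.1 (hiso x))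
  obtain ⟨r, ⟨⟨hr1, hr2⟩, hrK⟩, hr⟩ :=
    (((hγ.eventually hg).and hK).and (Ioo_mem_nhdsGT (zero_lt_one (α := ℝ)))).exists
  have hne : g (F x + r • v) ≠ x := by
    intro h
    rw [h] at hr1
    have h0 : r • v = 0 := by simpa using hr1
    exact (smul_ne_zero hr.1.ne' hv0) h0
  have h1 : y - F (g (F x + r • v)) = (1 - r) • v := by rw [hr1, hv]; module
  have h1' : y ≠ F (g (F x + r • v)) := by
    rw [← sub_ne_zero, h1]
    exact smul_ne_zero (sub_pos.2 hr.2).ne' hv0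
  obtain ⟨z, hz1, hz2⟩ := exists_preimage_norm_sub_lt_of_lt hF hunit hinv (hrK hne) h1'
  refine ⟨z, hz1, ?_⟩
  simp only [Function.comp_apply] at hz2
  rw [h1, norm_smul, Real.norm_of_nonneg (sub_pos.2 hr.2).le] at hz2
  rw [add_sub_cancel_left, norm_smul, Real.norm_of_nonneg hr.1.le] at hr2
  have h2 := norm_sub_le_norm_sub_add_norm_sub z (g (F x + r • v)) x
  linarith

/-- Uniform gain in `exists_preimage_norm_sub_lt` over a compact set of base points and displacements
bounded above and away from zero. -/
theorem exists_uniform_preimage_norm_sub_le [ProperSpace E] {F : E → E} (hF : ContDiff ℝ 1 F)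
    (hunit : ∀ x, IsUnit (fderiv ℝ F x)) (hinv : ∀ x, ‖Ring.inverse (fderiv ℝ F x)‖ ≤ 1)
    (hiso : ∀ x, ∀ᶠ z in 𝓝[≠] x, ‖Ring.inverse (fderiv ℝ F z)‖ < 1)
    {K : Set E} (hK : IsCompact K) {ε : ℝ} (hε : 0 < ε) (R : ℝ) :
    ∃ δ > 0, ∀ x ∈ K, ∀ y, ε ≤ ‖y - F x‖ → ‖y - F x‖ ≤ R →
      ∃ z, F z = y ∧ ‖z - x‖ ≤ ‖y - F x‖ - δ := by
  have : CompleteSpace E := complete_of_proper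
  have hFc := hF.continuous
  -- Pairs of a base point and a displacement.
  have hC : IsCompact (K ×ˢ (Metric.closedBall (0 : E) R ∩ {v | ε ≤ ‖v‖})) :=
    hK.prod ((isCompact_closedBall _ _).inter_right (isClosed_le (by fun_prop) (by fun_prop)))
  have hloc : ∃ δ > 0, ∀ p ∈ K ×ˢ (Metric.closedBall (0 : E) R ∩ {v | ε ≤ ‖v‖}),
      ∃ z, F z = F p.1 + p.2 ∧ ‖z - p.1‖ ≤ ‖p.2‖ - δ := by
    refine hC.induction_on (p := fun s => ∃ δ > 0, ∀ p ∈ s,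
      ∃ z, F z = F p.1 + p.2 ∧ ‖z - p.1‖ ≤ ‖p.2‖ - δ) ⟨1, one_pos, by simp⟩ ?_ ?_ ?_
    · rintro s t hst ⟨δ, hδ, h⟩
      exact ⟨δ, hδ, fun p hp => h p (hst hp)⟩
    · rintro s t ⟨δ, hδ, h⟩ ⟨δ', hδ', h'⟩
      refine ⟨min δ δ', lt_min hδ hδ', ?_⟩
      rintro p (hp | hp)
      · obtain ⟨z, h1, h2⟩ := h p hp
        exact ⟨z, h1, h2.trans (by linarith [min_le_left δ δ'])⟩
      · obtain ⟨z, h1, h2⟩ := h' p hp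
        exact ⟨z, h1, h2.trans (by linarith [min_le_right δ δ'])⟩
    · rintro ⟨x, v⟩ ⟨-, -, hv : ε ≤ ‖v‖⟩
      have hv0 : v ≠ 0 := norm_pos_iff.1 (hε.trans_le hv)
      obtain ⟨w, hw1, hw2⟩ := exists_preimage_norm_sub_lt hF hunit hinv hiso
        (x := x) (y := F x + v) (by simpa using hv0)
      rw [add_sub_cancel_left] at hw2
      obtain ⟨g, hgw, hgc, hg⟩ :=
        exists_local_right_inverse hF hunit w 1 (Eventually.of_forall hinv)
      have ht : Tendsto (fun p : E × E => F p.1 + p.2) (𝓝 (x, v)) (𝓝 (F w)) := by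
        rw [hw1]
        exact (by fun_prop : Continuous fun p : E × E => F p.1 + p.2).tendsto (x, v)
      have hgt : Tendsto (fun p : E × E => g (F p.1 + p.2)) (𝓝 (x, v)) (𝓝 w) := by
        have := hgc.tendsto
        rw [hgw] at this
        exact this.comp ht
      have hgap : Tendsto (fun p : E × E => ‖p.2‖ - ‖g (F p.1 + p.2) - p.1‖) (𝓝 (x, v))
          (𝓝 (‖v‖ - ‖w - x‖)) :=
        (continuous_snd.tendsto (x, v)).norm.sub (hgt.sub (continuous_fst.tendsto (x, v))).norm
      obtain ⟨δ, hδ, hδ'⟩ := exists_between (sub_pos.2 hw2)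
      refine ⟨_, mem_nhdsWithin_of_mem_nhds
        ((ht.eventually hg).and (hgap.eventually (lt_mem_nhds hδ'))), δ, hδ, ?_⟩
      rintro p ⟨⟨h1, -⟩, h2⟩
      exact ⟨_, h1, by linarith⟩
  obtain ⟨δ, hδ, h⟩ := hloc
  refine ⟨δ, hδ, fun x hx y h1 h2 => ?_⟩
  obtain ⟨z, hz1, hz2⟩ := h (x, y - F x) ⟨hx, by simpa using h2, h1⟩
  exact ⟨z, by simpa using hz1, hz2⟩

end Expansion

theorem tproj_eq_iff {n : ℕ} {x y : Fin n → ℝ} :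
    tproj n x = tproj n y ↔ ∃ k : Fin n → ℤ, y = x + fun i => (k i : ℝ) := by
  constructor
  · intro h
    have h1 : ∀ i, ∃ k : ℤ, y i = x i + k := by
      intro i
      have hi : ((x i : ℝ) : AddCircle (1 : ℝ)) = (y i : ℝ) := congrFun h i
      obtain ⟨k, hk⟩ := (QuotientAddGroup.eq.1 hi)
      refine ⟨k, ?_⟩
      simp at hk
      linarith
    choose k hk using h1
    exact ⟨k, funext hk⟩
  · rintro ⟨k, rfl⟩
    funext i
    refine QuotientAddGroup.eq.2 ⟨k i, ?_⟩
    simp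

theorem tproj_add_intCast {n : ℕ} (x : Fin n → ℝ) (k : Fin n → ℤ) :
    tproj n (x + fun i => (k i : ℝ)) = tproj n x :=
  (tproj_eq_iff.2 ⟨k, rfl⟩).symm

/-- Every point of the torus has a representative in each unit cube. -/
theorem exists_tproj_eq_of_base {n : ℕ} (p : Fin n → ℝ) (t : Torus n) :
    ∃ y, tproj n y = t ∧ ∀ i, y i - p i ∈ Icc (0 : ℝ) 1 := by
  have h : ∀ i, ∃ a : ℝ, (a : AddCircle (1 : ℝ)) = t i ∧ a - p i ∈ Icc (0 : ℝ) 1 := by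
    intro i
    obtain ⟨b, hb⟩ := QuotientAddGroup.mk_surjective (t i)
    refine ⟨p i + Int.fract (b - p i), ?_, ?_⟩
    · rw [← hb]
      refine QuotientAddGroup.eq.2 ⟨⌊b - p i⌋, ?_⟩
      have h := Int.floor_add_fract (b - p i)
      change (⌊b - p i⌋ • (1 : ℝ)) = -(p i + Int.fract (b - p i)) + b
      rw [zsmul_one]
      linarith
    · rw [add_sub_cancel_left]
      exact ⟨Int.fract_nonneg _, (Int.fract_lt_one _).le⟩
  choose a ha using h
  exact ⟨a, funext fun i => (ha i).1, fun i => (ha i).2⟩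

theorem tproj_eventually_ne {n : ℕ} (x : Fin n → ℝ) :
    ∀ᶠ z in 𝓝[≠] x, tproj n z ≠ tproj n x := by
  rw [eventually_nhdsWithin_iff]
  filter_upwards [Metric.ball_mem_nhds x one_pos] with z hz hne h
  obtain ⟨k, hk⟩ := tproj_eq_iff.1 h
  apply hne
  have hk0 : ∀ i, k i = 0 := by
    intro i
    have h1 : |z i - x i| < 1 := by
      have h2 := norm_le_pi_norm (z - x) i
      rw [mem_ball_iff_norm] at hz
      exact lt_of_le_of_lt h2 hz
    rw [hk] at h1
    have h3 : |(k i : ℝ)| < 1 := by simpa using h1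
    exact Int.abs_lt_one_iff.1 (by exact_mod_cast h3)
  rw [mem_singleton_iff, hk]
  funext i
  simp [hk0 i]

namespace TorusHyp

variable {n : ℕ} {α : ℝ} {f : Torus n → Torus n} {F : (Fin n → ℝ) → Fin n → ℝ}

theorem contDiff (hyp : TorusHyp n α f F) : ContDiff ℝ 1 F := by
  rw [contDiff_one_iff_fderiv]
  refine ⟨hyp.hdiff, continuous_iff_continuousAt.2 fun x => ?_⟩
  obtain ⟨C, hC⟩ := hyp.hHolder
  rw [ContinuousAt, tendsto_iff_norm_sub_tendsto_zero]
  refine squeeze_zero (fun _ => norm_nonneg _) (fun z => hC z x) ?_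
  have h : Tendsto (fun z => ‖z - x‖) (𝓝 x) (𝓝 0) := by
    have := ((by fun_prop : Continuous fun z : Fin n → ℝ => ‖z - x‖).tendsto x)
    simpa using this
  have h2 := (h.rpow_const (Or.inr hyp.hα0.le) : Tendsto (fun z => ‖z - x‖ ^ α) _ _).const_mul C
  simpa [Real.zero_rpow hyp.hα0.ne'] using h2

theorem eventually_norm_inverse_lt (hyp : TorusHyp n α f F) (x : Fin n → ℝ) :
    ∀ᶠ z in 𝓝[≠] x, ‖Ring.inverse (fderiv ℝ F z)‖ < 1 := by
  have hfin : ((tproj n '' KsetF n F) \ {tproj n x}).Finite := hyp.hKfin.sdiff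
  have hopen : ∀ᶠ z in 𝓝[≠] x, tproj n z ∉ (tproj n '' KsetF n F) \ {tproj n x} :=
    ((continuous_tproj n).continuousAt.eventually
      (hfin.isClosed.isOpen_compl.mem_nhds (by simp))).filter_mono nhdsWithin_le_nhds
  filter_upwards [hopen, tproj_eventually_ne x] with z h1 h2
  exact lt_of_le_of_ne (hyp.hinvnorm z) fun h => h1 ⟨⟨z, h, rfl⟩, h2⟩

theorem exists_uniform_preimage (hyp : TorusHyp n α f F) {ε : ℝ} (hε : 0 < ε) (R : ℝ) :
    ∃ δ > 0, ∀ x y : Fin n → ℝ, ε ≤ ‖y - F x‖ → ‖y - F x‖ ≤ R →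
      ∃ z, f (tproj n z) = tproj n y ∧ ‖z - x‖ ≤ ‖y - F x‖ - δ := by
  obtain ⟨δ, hδ, h⟩ := exists_uniform_preimage_norm_sub_le hyp.contDiff hyp.hunit hyp.hinvnorm
    hyp.eventually_norm_inverse_lt (isCompact_Icc (a := (0 : Fin n → ℝ)) (b := 1)) hε R
  refine ⟨δ, hδ, fun x y h1 h2 => ?_⟩
  obtain ⟨x₀, hx₀, hmem⟩ := exists_tproj_eq_of_base 0 (tproj n x)
  have hx₀K : x₀ ∈ Icc (0 : Fin n → ℝ) 1 :=
    ⟨fun i => by simpa using (hmem i).1, fun i => by simpa using (hmem i).2⟩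
  obtain ⟨k, rfl⟩ := tproj_eq_iff.1 hx₀
  have hm : tproj n (F x₀) = tproj n (F (x₀ + fun i => (k i : ℝ))) := by
    rw [← hyp.hlift, ← hyp.hlift, hx₀]
  obtain ⟨m, hm⟩ := tproj_eq_iff.1 hm
  have hy : y - (fun i => (m i : ℝ)) - F x₀ = y - F (x₀ + fun i => (k i : ℝ)) := by
    rw [hm]; abel
  obtain ⟨z, hz1, hz2⟩ := h x₀ hx₀K (y - fun i => (m i : ℝ)) (by rwa [hy]) (by rwa [hy])
  refine ⟨z + fun i => (k i : ℝ), ?_, ?_⟩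
  · rw [tproj_add_intCast, hyp.hlift, hz1, ← tproj_add_intCast _ m, sub_add_cancel]
  · rwa [hy, ← add_sub_add_right_eq_sub z x₀ (fun i => (k i : ℝ))] at hz2

end TorusHyp

/-- every nonempty open subset of the torus covers the whole torus
after finitely many iterates of `f`. -/
theorem iterate_image_open_eq_univ
    (n : ℕ) (α : ℝ) (f : Torus n → Torus n) (F : (Fin n → ℝ) → Fin n → ℝ)
    (hyp : TorusHyp n α f F) :
    ∀ U : Set (Torus n), IsOpen U → U.Nonempty →
      ∃ N : ℕ, 1 ≤ N ∧ f^[N] '' U = Set.univ := by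
  rintro U hU ⟨t, ht⟩
  obtain ⟨x, rfl, -⟩ := exists_tproj_eq_of_base 0 t
  obtain ⟨ε, hε, hball⟩ := Metric.nhds_basis_closedBall.mem_iff.1
    ((continuous_tproj n).continuousAt.preimage_mem_nhds (hU.mem_nhds ht))
  obtain ⟨δ, hδ, hgain⟩ := hyp.exists_uniform_preimage hε 1
  have hgrow : ∀ N : ℕ, ∃ p : Fin n → ℝ, ∀ y, ‖y - p‖ ≤ max ε (min 1 (N * δ)) →
      tproj n y ∈ f^[N] '' U := by
    intro N
    induction N with
    | zero =>
      refine ⟨x, fun y hy => ⟨_, hball (mem_closedBall_iff_norm.2 ?_), rfl⟩⟩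
      simpa [hε.le] using hy
    | succ N ih =>
      obtain ⟨p, hp⟩ := ih
      refine ⟨F p, fun y hy => ?_⟩
      obtain ⟨z, hz1, hz2⟩ : ∃ z, f (tproj n z) = tproj n y ∧
          ‖z - p‖ ≤ max ε (min 1 (N * δ)) := by
        rcases le_total ‖y - F p‖ ε with hle | hle
        · obtain ⟨z, hz1, hz2⟩ :=
            exists_preimage_norm_sub_le hyp.contDiff hyp.hunit hyp.hinvnorm p y
          exact ⟨z, by rw [hyp.hlift, hz1], le_max_of_le_left (hz2.trans hle)⟩
        · rcases le_max_iff.1 hy with hle' | hle'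
          · obtain ⟨z, hz1, hz2⟩ :=
              exists_preimage_norm_sub_le hyp.contDiff hyp.hunit hyp.hinvnorm p y
            exact ⟨z, by rw [hyp.hlift, hz1], le_max_of_le_left (hz2.trans hle')⟩
          · obtain ⟨h1, h2⟩ := le_min_iff.1 hle'
            obtain ⟨z, hz1, hz2⟩ := hgain p y hle h1
            push_cast at h2
            exact ⟨z, hz1, le_max_of_le_right (le_min (by linarith) (by linarith))⟩
      obtain ⟨u, hu, hu'⟩ := hp z hz2
      exact ⟨u, hu, by rw [Function.iterate_succ_apply', hu', hz1]⟩
  obtain ⟨N, hN⟩ := exists_nat_gt (1 / δ)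
  have hN1 : 1 < N * δ := (div_lt_iff₀ hδ).1 hN
  have hN0 : N ≠ 0 := by
    rintro rfl
    norm_num at hN1
  refine ⟨N, Nat.one_le_iff_ne_zero.2 hN0, eq_univ_of_forall fun s => ?_⟩
  obtain ⟨p, hp⟩ := hgrow N
  obtain ⟨y, rfl, hy⟩ := exists_tproj_eq_of_base p s
  have hy1 : ‖y - p‖ ≤ 1 := (pi_norm_le_iff_of_nonneg zero_le_one).2 fun i => by
    rw [Pi.sub_apply, Real.norm_of_nonneg (hy i).1]
    exact (hy i).2
  exact hp y (le_max_of_le_right (le_min hy1 (hy1.trans hN1.le)))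
end
end
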